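/- arXiv:1707.01634 — 4 statements merged into one kernel-verified Lean document; each statement's English description precedes it below -/
import Mathlib

section
/- Let G be a connected graph. Then from every nontrivial block of G (i.e., every 2-connected block) one can choose an edge such that the set of all chosen edges forms a matching in G. -/
open SimpleGraph

/-- Degree of a vertex. -/
noncomputable def vdeg {V : Type*} (G : SimpleGraph V) (v : V) : ℕ := (G.neighborSet v).ncard

/-- An edge-coloring `c` makes `G` conflict-free connected if any two distinct vertices are
joined by a path on which some color appears on exactly one edge. -/
def IsCFConnected {V : Type*} (G : SimpleGraph V) (c : Sym2 V → ℕ) : Prop :=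
  ∀ u v : V, u ≠ v → ∃ p : G.Walk u v, p.IsPath ∧
    ∃ col : ℕ, (p.edges.filter (fun e => c e = col)).length = 1

/-- The conflict-free connection number of `G`. -/
noncomputable def cfcNum {V : Type*} (G : SimpleGraph V) : ℕ :=
  sInf {k | ∃ c : Sym2 V → ℕ, (∀ e ∈ G.edgeSet, c e < k) ∧ IsCFConnected G c}

/-- The subgraph `C(G)` spanned by the cut edges (bridges) of `G`. -/
def bridgeGraph {V : Type*} (G : SimpleGraph V) : SimpleGraph V :=
  SimpleGraph.fromEdgeSet {e | G.IsBridge e}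

/-- A linear forest: an acyclic graph with maximum degree at most two. -/
def IsLinearForest {V : Type*} (H : SimpleGraph V) : Prop :=
  H.IsAcyclic ∧ ∀ v, (H.neighborSet v).ncard ≤ 2

/-- A subgraph has no cut vertex: deleting any vertex leaves it connected. -/
def NoCutVertex {V : Type*} (G : SimpleGraph V) (H : G.Subgraph) : Prop :=
  ∀ v ∈ H.verts, (H.verts \ {v}).Nonempty → (H.deleteVerts {v}).Connected

/-- A block of G: a maximal connected subgraph without a cut vertex. -/
def IsBlock {V : Type*} (G : SimpleGraph V) (H : G.Subgraph) : Prop :=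
  H.verts.Nonempty ∧ H.Connected ∧ NoCutVertex G H ∧
    ∀ H' : G.Subgraph, H ≤ H' → H'.Connected → NoCutVertex G H' → H' = H

namespace SimpleGraph

variable {V : Type*} {G : SimpleGraph V}

/-- Two vertices are linked in a subgraph if some walk inside the subgraph joins them. -/
def Subgraph.Linked (D : G.Subgraph) (x y : V) : Prop :=
  ∃ p : G.Walk x y, p.toSubgraph ≤ D

namespace Subgraph.Linked

variable {D E : G.Subgraph} {x y z : V}

lemma refl (hx : x ∈ D.verts) : D.Linked x x :=
  ⟨.nil, by simpa using hx⟩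

lemma symm (h : D.Linked x y) : D.Linked y x := by
  obtain ⟨p, hp⟩ := h
  exact ⟨p.reverse, by simpa using hp⟩

lemma trans (h : D.Linked x y) (h' : D.Linked y z) : D.Linked x z := by
  obtain ⟨p, hp⟩ := h
  obtain ⟨q, hq⟩ := h'
  exact ⟨p.append q, by simpa using ⟨hp, hq⟩⟩

lemma mono (hDE : D ≤ E) (h : D.Linked x y) : E.Linked x y := by
  obtain ⟨p, hp⟩ := h
  exact ⟨p, hp.trans hDE⟩

lemma of_adj (h : D.Adj x y) : D.Linked x y :=
  ⟨.cons h.adj_sub .nil, by simpa using h⟩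

end Subgraph.Linked

lemma Subgraph.Connected.linked {D : G.Subgraph} (hD : D.Connected) {x y : V}
    (hx : x ∈ D.verts) (hy : y ∈ D.verts) : D.Linked x y :=
  (Subgraph.connected_iff_forall_exists_walk_subgraph D).1 hD |>.2 hx hy

lemma Subgraph.connected_of_linked {D : G.Subgraph} {c : V} (hc : c ∈ D.verts)
    (h : ∀ x ∈ D.verts, D.Linked x c) : D.Connected :=
  (Subgraph.connected_iff_forall_exists_walk_subgraph D).2
    ⟨⟨c, hc⟩, fun hx hy => (h _ hx).trans (h _ hy).symm⟩

lemma Subgraph.deleteVerts_singleton_of_notMem {D : G.Subgraph} {w : V} (hw : w ∉ D.verts) :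
    D.deleteVerts {w} = D := by
  rw [← Subgraph.deleteVerts_inter_verts_left_eq, Set.inter_singleton_eq_empty.2 hw,
    Subgraph.deleteVerts_empty]

/-- Every vertex of a path other than `w` can be linked to one of the two ends avoiding `w`. -/
lemma Walk.IsPath.linked_deleteVerts {a b : V} {p : G.Walk a b} (hp : p.IsPath) {w x : V}
    (hx : x ∈ p.support) (hxw : x ≠ w) :
    (a ≠ w ∧ (p.toSubgraph.deleteVerts {w}).Linked x a) ∨
      (b ≠ w ∧ (p.toSubgraph.deleteVerts {w}).Linked x b) := by
  induction p with
  | nil =>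
    obtain rfl : x = _ := by simpa using hx
    exact .inl ⟨hxw, .refl (by simp [hxw])⟩
  | @cons a c b h q ih =>
    rw [Walk.cons_isPath_iff] at hp
    have hle : q.toSubgraph.deleteVerts {w} ≤ (Walk.cons h q).toSubgraph.deleteVerts {w} :=
      Subgraph.deleteVerts_mono le_sup_right
    by_cases hxa : x = a
    · subst hxa
      exact .inl ⟨hxw, .refl (by simp [hxw])⟩
    have hxq : x ∈ q.support := by simpa [hxa] using hx
    by_cases haw : a = w
    · subst haw
      refine .inr ⟨fun hb => hp.2 (hb ▸ q.end_mem_support), .mono hle ?_⟩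
      rw [Subgraph.deleteVerts_singleton_of_notMem (by simpa using hp.2)]
      exact q.toSubgraph_connected.linked (by simpa using hxq) (by simp)
    · rcases ih hp.1 hxq with ⟨hcw, hl⟩ | ⟨hbw, hl⟩
      · refine .inl ⟨haw, (hl.mono hle).trans (Subgraph.Linked.of_adj ?_)⟩
        simp [haw, hcw]
      · exact .inr ⟨hbw, hl.mono hle⟩

/-- A vertex `r` of `H` at minimal distance from `o` reaches `o` avoiding any other vertex
of `H`. -/
lemma Connected.exists_walk_notMem_support (hG : G.Connected) {r o v : V} (hv : v ≠ r)
    (hr : G.dist r o ≤ G.dist v o) : ∃ p : G.Walk r o, v ∉ p.support := by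
  classical
  obtain ⟨p, hp⟩ := hG.exists_walk_length_eq_dist r o
  refine ⟨p, fun hvp => ?_⟩
  have hlen := congrArg Walk.length (p.take_spec hvp)
  rw [Walk.length_append] at hlen
  have h1 := dist_le (p.dropUntil v hvp)
  have h2 : (p.takeUntil v hvp).length ≠ 0 := fun h => hv (Walk.eq_of_length_eq_zero h).symm
  omega

end SimpleGraph

section Block

variable {V : Type*} {G : SimpleGraph V} {H H₁ H₂ : G.Subgraph}

lemma NoCutVertex.linked_deleteVerts (hH : NoCutVertex G H) (hc : H.Connected) {w x y : V}
    (hx : x ∈ H.verts) (hy : y ∈ H.verts) (hxw : x ≠ w) (hyw : y ≠ w) :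
    (H.deleteVerts {w}).Linked x y := by
  have hconn : (H.deleteVerts {w}).Connected := by
    by_cases hw : w ∈ H.verts
    · exact hH w hw ⟨x, hx, hxw⟩
    · rwa [Subgraph.deleteVerts_singleton_of_notMem hw]
  exact hconn.linked ⟨hx, hxw⟩ ⟨hy, hyw⟩

/-- A connected subgraph without cut vertex on at least three vertices has an edge avoiding any
prescribed vertex. -/
lemma NoCutVertex.exists_adj_ne (hH : NoCutVertex G H) (hc : H.Connected)
    (h3 : 3 ≤ H.verts.ncard) (r : V) : ∃ a b, H.Adj a b ∧ a ≠ r ∧ b ≠ r := by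
  obtain ⟨x, y, z, hx, hy, hz, hxy, hxz, hyz⟩ :=
    (Set.two_lt_ncard (Set.finite_of_ncard_pos (by omega))).1 h3
  obtain ⟨x, y, hx, hy, hxy, hxr, hyr⟩ :
      ∃ x y, x ∈ H.verts ∧ y ∈ H.verts ∧ x ≠ y ∧ x ≠ r ∧ y ≠ r := by
    grind
  obtain ⟨p, hp⟩ := hH.linked_deleteVerts hc hx hy hxr hyr
  cases p with
  | nil => exact absurd rfl hxy
  | @cons _ c _ h q =>
    have hadj : (H.deleteVerts {r}).Adj x c := hp.2 (by simp)
    rw [Subgraph.deleteVerts_adj] at hadj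
    exact ⟨x, c, hadj.2.2.2.2, hadj.2.1, hadj.2.2.2.1⟩

/-- Two blocks sharing a vertex `v` coincide if they are joined by a walk avoiding `v`. -/
lemma IsBlock.eq_of_walk (h₁ : IsBlock G H₁) (h₂ : IsBlock G H₂) {v a b : V}
    (hv₁ : v ∈ H₁.verts) (hv₂ : v ∈ H₂.verts) (ha : a ∈ H₁.verts) (hb : b ∈ H₂.verts)
    (q : G.Walk a b) (hq : v ∉ q.support) : H₁ = H₂ := by
  classical
  obtain ⟨p, hp, hvp⟩ : ∃ p : G.Walk a b, p.IsPath ∧ v ∉ p.support :=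
    ⟨q.bypass, q.bypass_isPath, fun h => hq (q.support_bypass_subset_support h)⟩
  obtain ⟨-, hc₁, hn₁, hm₁⟩ := h₁
  obtain ⟨-, hc₂, hn₂, hm₂⟩ := h₂
  set K : G.Subgraph := H₁ ⊔ H₂ ⊔ p.toSubgraph with hK
  have le₁ : H₁ ≤ K := le_sup_left.trans le_sup_left
  have le₂ : H₂ ≤ K := le_sup_right.trans le_sup_left
  have le₃ : p.toSubgraph ≤ K := le_sup_right
  have mem_K : ∀ x, x ∈ K.verts ↔ (x ∈ H₁.verts ∨ x ∈ H₂.verts) ∨ x ∈ p.support := by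
    simp [hK]
  have hKc : K.Connected := by
    have h₁₂ := Subgraph.connected_sup hc₁.preconnected hc₂.preconnected ⟨v, hv₁, hv₂⟩
    exact Subgraph.connected_sup h₁₂.preconnected p.toSubgraph_connected.preconnected
      ⟨a, .inl ha, by simp⟩
  have hKn : NoCutVertex G K := by
    intro w _ _
    have l₁ {x y : V} (hx : x ∈ H₁.verts) (hy : y ∈ H₁.verts) (hxw : x ≠ w) (hyw : y ≠ w) :
        (K.deleteVerts {w}).Linked x y :=
      (hn₁.linked_deleteVerts hc₁ hx hy hxw hyw).mono (Subgraph.deleteVerts_mono le₁)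
    have l₂ {x y : V} (hx : x ∈ H₂.verts) (hy : y ∈ H₂.verts) (hxw : x ≠ w) (hyw : y ≠ w) :
        (K.deleteVerts {w}).Linked x y :=
      (hn₂.linked_deleteVerts hc₂ hx hy hxw hyw).mono (Subgraph.deleteVerts_mono le₂)
    by_cases hwv : w = v
    · subst hwv
      have hpw : p.toSubgraph ≤ K.deleteVerts {w} := by
        rw [← Subgraph.deleteVerts_singleton_of_notMem (D := p.toSubgraph) (by simpa using hvp)]
        exact Subgraph.deleteVerts_mono le₃
      have l₃ {x : V} (hx : x ∈ p.support) : (K.deleteVerts {w}).Linked x a :=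
        (p.toSubgraph_connected.linked (by simpa using hx) (by simp)).mono hpw
      have haw : a ≠ w := fun h => hvp (h ▸ p.start_mem_support)
      have hbw : b ≠ w := fun h => hvp (h ▸ p.end_mem_support)
      refine Subgraph.connected_of_linked (c := a) ⟨le₁.1 ha, haw⟩ ?_
      rintro x ⟨hx, hxw⟩
      rcases (mem_K x).1 hx with (hx | hx) | hx
      · exact l₁ hx ha hxw haw
      · exact (l₂ hx hb hxw hbw).trans (l₃ p.end_mem_support)
      · exact l₃ hx
    · have hvw : v ≠ w := Ne.symm hwv
      refine Subgraph.connected_of_linked (c := v) ⟨le₁.1 hv₁, hvw⟩ ?_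
      rintro x ⟨hx, hxw⟩
      rcases (mem_K x).1 hx with (hx | hx) | hx
      · exact l₁ hx hv₁ hxw hvw
      · exact l₂ hx hv₂ hxw hvw
      · rcases hp.linked_deleteVerts hx hxw with ⟨haw, hl⟩ | ⟨hbw, hl⟩
        · exact (hl.mono (Subgraph.deleteVerts_mono le₃)).trans (l₁ ha hv₁ haw hvw)
        · exact (hl.mono (Subgraph.deleteVerts_mono le₃)).trans (l₂ hb hv₂ hbw hvw)
  rw [← hm₁ K le₁ hKc hKn, ← hm₂ K le₂ hKc hKn]

end Block

theorem stmt_9 {V : Type*} [Fintype V] (G : SimpleGraph V) (hG : G.Connected) :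
    ∃ f : G.Subgraph → Sym2 V,
      (∀ H : G.Subgraph, IsBlock G H → 3 ≤ H.verts.ncard → f H ∈ H.edgeSet) ∧
      ∀ H₁ H₂ : G.Subgraph, IsBlock G H₁ → 3 ≤ H₁.verts.ncard →
        IsBlock G H₂ → 3 ≤ H₂.verts.ncard → H₁ ≠ H₂ →
        ∀ v : V, v ∈ f H₁ → v ∉ f H₂ := by
  obtain ⟨o⟩ := hG.nonempty
  have key : ∀ H : G.Subgraph, ∃ e : Sym2 V, IsBlock G H → 3 ≤ H.verts.ncard →
      e ∈ H.edgeSet ∧ ∃ r ∈ H.verts, (∀ x ∈ H.verts, G.dist r o ≤ G.dist x o) ∧ r ∉ e := by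
    intro H
    by_cases h : IsBlock G H ∧ 3 ≤ H.verts.ncard
    · obtain ⟨⟨hne, hc, hn, -⟩, h3⟩ := h
      obtain ⟨r, hr, hmin⟩ := H.verts.toFinite.exists_minimalFor (G.dist · o) _ hne
      obtain ⟨a, b, hab, har, hbr⟩ := hn.exists_adj_ne hc h3 r
      refine ⟨s(a, b), fun _ _ => ⟨hab, r, hr, fun x hx => ?_, ?_⟩⟩
      · exact (le_total (G.dist r o) (G.dist x o)).elim id (hmin hx)
      · simp [har.symm, hbr.symm]
    · exact ⟨s(o, o), fun h₁ h₂ => absurd ⟨h₁, h₂⟩ h⟩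
  choose f hf using key
  refine ⟨f, fun H hb h3 => (hf H hb h3).1, ?_⟩
  intro H₁ H₂ hb₁ h3₁ hb₂ h3₂ hne v hv₁ hv₂
  obtain ⟨he₁, r₁, hr₁, hmin₁, hre₁⟩ := hf H₁ hb₁ h3₁
  obtain ⟨he₂, r₂, hr₂, hmin₂, hre₂⟩ := hf H₂ hb₂ h3₂
  have hvH₁ := H₁.mem_verts_of_mem_edge he₁ hv₁
  have hvH₂ := H₂.mem_verts_of_mem_edge he₂ hv₂
  obtain ⟨p₁, hp₁⟩ := hG.exists_walk_notMem_support (ne_of_mem_of_not_mem hv₁ hre₁) (hmin₁ v hvH₁)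
  obtain ⟨p₂, hp₂⟩ := hG.exists_walk_notMem_support (ne_of_mem_of_not_mem hv₂ hre₂) (hmin₂ v hvH₂)
  exact hne (hb₁.eq_of_walk hb₂ hvH₁ hvH₂ hr₁ hr₂ (p₁.append p₂.reverse)
    (by simp [Walk.mem_support_append_iff, hp₁, hp₂]))
end

section
/- Let G be a connected non-complete graph of order n ≥ 25 such that the subgraph induced by the cut edges of G is a linear forest. If δ(G) ≥ (n−4)/5, then cfc(G) = 2. -/
open SimpleGraph

theorem exists_unique_color_of_forall {V : Type*} {G : SimpleGraph V} {u v : V}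
    {p : G.Walk u v} (hp : p.IsPath) {c : Sym2 V → ℕ} {f : Sym2 V} (hf : f ∈ p.edges)
    (huniq : ∀ g ∈ p.edges, c g = c f → g = f) :
    ∃ col : ℕ, (p.edges.filter (fun e => c e = col)).length = 1 := by
  classical
  refine ⟨c f, ?_⟩
  rw [← List.count_eq_one_of_mem hp.isTrail.edges_nodup hf, List.count,
    ← List.countP_eq_length_filter]
  refine List.countP_congr fun g hg => ?_
  simp only [decide_eq_true_eq, beq_iff_eq]
  exact ⟨huniq g hg, fun h => h ▸ rfl⟩

/-- A connected graph falls into at most two components when an edge is deleted. -/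
theorem SimpleGraph.Connected.reachable_deleteEdges_or {V : Type*} {T : SimpleGraph V}
    (hT : T.Connected) (a b z : V) :
    (T.deleteEdges {s(a, b)}).Reachable z a ∨ (T.deleteEdges {s(a, b)}).Reachable z b := by
  by_contra hz
  obtain ⟨w⟩ := hT z a
  obtain ⟨d, -, hd1, hd2⟩ := w.exists_boundary_dart
    {x | ¬ ((T.deleteEdges {s(a, b)}).Reachable x a ∨ (T.deleteEdges {s(a, b)}).Reachable x b)}
    hz (by simp)
  simp only [Set.mem_ofPred_eq, not_not] at hd1 hd2
  by_cases he : s(d.fst, d.snd) = s(a, b)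
  · rcases Sym2.eq_iff.1 he with ⟨h, -⟩ | ⟨h, -⟩
    · exact hd1 (Or.inl (h ▸ Reachable.refl _))
    · exact hd1 (Or.inr (h ▸ Reachable.refl _))
  · have hadj : (T.deleteEdges {s(a, b)}).Adj d.fst d.snd := by
      simp only [deleteEdges_adj, Set.mem_singleton_iff]
      exact ⟨d.adj, he⟩
    exact hd1 (hd2.imp hadj.reachable.trans hadj.reachable.trans)

/-- If the tree path between two vertices uses an edge which is not a bridge, then some path
between them has exactly one edge outside the tree. -/
theorem SimpleGraph.IsTree.exists_isPath_unique_notMem {V : Type*} {G T : SimpleGraph V}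
    (hG : G.Connected) (hT : T.IsTree) (hTG : T ≤ G) {u v : V} {q : T.Walk u v} (hq : q.IsPath)
    {e : Sym2 V} (he : e ∈ q.edges) (heb : ¬ G.IsBridge e) :
    ∃ p : G.Walk u v, p.IsPath ∧ ∃ f ∈ p.edges, f ∉ T.edgeSet ∧
      ∀ g ∈ p.edges, g ∉ T.edgeSet → g = f := by
  classical
  induction e with | h a b
  set T' := T.deleteEdges {s(a, b)} with hT'
  have hT'T : T' ≤ T := deleteEdges_le _
  have hsep : ¬ T'.Reachable u v := by
    intro h
    obtain ⟨p, hp⟩ := h.exists_isPath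
    have heq := congrArg Subtype.val
      ((hT.isAcyclic.subsingleton_path u v).elim ⟨q, hq⟩
        ⟨p.mapLe hT'T, (Walk.isPath_mapLe hT'T).2 hp⟩)
    simp only at heq
    rw [heq, Walk.edges_mapLe_eq_edges] at he
    have := p.edges_subset_edgeSet he
    simp [hT'] at this
  obtain ⟨w⟩ := hG.connected_delete_edge_of_not_isBridge heb u v
  obtain ⟨d, -, hd1, hd2⟩ := w.exists_boundary_dart {z | T'.Reachable u z} (Reachable.refl u) hsep
  simp only [Set.mem_ofPred_eq] at hd1 hd2
  obtain ⟨hdG, hde⟩ : G.Adj d.fst d.snd ∧ s(d.fst, d.snd) ≠ s(a, b) := by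
    simpa only [deleteEdges_adj, Set.mem_singleton_iff] using d.adj
  have hfT : s(d.fst, d.snd) ∉ T.edgeSet := by
    intro h
    refine hd2 (hd1.trans (Adj.reachable ?_))
    simp only [hT', deleteEdges_adj, Set.mem_singleton_iff]
    exact ⟨h, hde⟩
  have hd3 : T'.Reachable d.snd v := by
    have key := fun z => hT.connected.reachable_deleteEdges_or a b z
    rcases key u with h1 | h1 <;> rcases key v with h2 | h2 <;>
      rcases key d.snd with h3 | h3
    all_goals first
      | exact h3.trans h2.symm
      | exact absurd (h1.trans h2.symm) hsep
      | exact absurd (h1.trans h3.symm) hd2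
  obtain ⟨p₁⟩ := hd1
  obtain ⟨p₂⟩ := hd3
  have hle := hT'T.trans hTG
  let p : G.Walk u v := (p₁.mapLe hle).append (Walk.cons hdG (p₂.mapLe hle))
  have hpe : ∀ g ∈ p.toPath.1.edges, g = s(d.fst, d.snd) ∨ g ∈ T'.edgeSet := by
    intro g hg
    have := p.edges_toPath_subset_edges hg
    simp only [p, Walk.edges_append, Walk.edges_cons, List.mem_append, List.mem_cons,
      Walk.edges_mapLe_eq_edges] at this
    rcases this with h | h | h
    · exact Or.inr (p₁.edges_subset_edgeSet h)
    · exact Or.inl h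
    · exact Or.inr (p₂.edges_subset_edgeSet h)
  refine ⟨p.toPath.1, p.toPath.2, s(d.fst, d.snd), ?_, hfT, ?_⟩
  · by_contra hf
    exact hsep ⟨p.toPath.1.transfer T' fun g hg =>
      (hpe g hg).resolve_left fun h => hf (h ▸ hg)⟩
  · exact fun g hg hgT => (hpe g hg).resolve_right fun h => hgT (edgeSet_mono hT'T h)

theorem SimpleGraph.IsBridge.mem_edgeSet_of_connected {V : Type*} {G : SimpleGraph V}
    (hG : G.Connected) {e : Sym2 V} (he : G.IsBridge e) : e ∈ G.edgeSet := by
  induction e with | h a b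
  exact he.reachable_iff_adj.1 (hG a b)

/-- A trail joining two vertices on the same side of a bridge avoids the bridge. -/
theorem SimpleGraph.IsBridge.notMem_edges_of_reachable {V : Type*} {G : SimpleGraph V}
    {r : Sym2 V} (hr : G.IsBridge r) {u v : V} (huv : (G.deleteEdges {r}).Reachable u v)
    {p : G.Walk u v} (hp : p.IsTrail) : r ∉ p.edges := by
  induction r with | h x y
  have hxy : ¬ (G.deleteEdges {s(x, y)}).Reachable x y := hr
  by_cases hy : (G.deleteEdges {s(x, y)}).Reachable u y
  · have hux : ¬ (G.deleteEdges {s(x, y)}).Reachable u x := fun h => hxy (h.symm.trans hy)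
    rw [Sym2.eq_swap] at huv hux ⊢
    exact hp.not_mem_edges_of_not_reachable hux fun h => hux (huv.trans h)
  · exact hp.not_mem_edges_of_not_reachable hy fun h => hy (huv.trans h)

/-- Two colors suffice as soon as at most one bridge can be removed so that the remaining bridges
form a matching. -/
theorem exists_two_coloring_of_bridges {V : Type*} {G : SimpleGraph V} (hG : G.Connected)
    {R : Set (Sym2 V)} (hRb : ∀ r ∈ R, G.IsBridge r) (hR : R.Subsingleton)
    (hmatch : ∀ v a b, G.IsBridge s(v, a) → G.IsBridge s(v, b) → s(v, a) ∉ R → s(v, b) ∉ R →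
      a = b) :
    ∃ c : Sym2 V → ℕ, (∀ e, c e < 2) ∧ IsCFConnected G c := by
  classical
  obtain ⟨T, hTG, hT⟩ := hG.exists_isTree_le
  let c : Sym2 V → ℕ := fun e => if e ∈ T.edgeSet ∧ e ∉ R then 0 else 1
  have hc1 : ∀ e, c e = 1 ↔ (e ∉ T.edgeSet ∨ e ∈ R) := by
    intro e; simp only [c]; split_ifs with h <;> grind
  have hc0 : ∀ e, c e = 0 ↔ (e ∈ T.edgeSet ∧ e ∉ R) := by
    intro e; simp only [c]; split_ifs with h <;> grind
  refine ⟨c, fun e => by simp only [c]; split_ifs <;> omega, fun u v huv => ?_⟩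
  obtain ⟨q, hq⟩ := hT.connected.exists_isPath u v
  have hqT : ∀ e ∈ (q.mapLe hTG).edges, e ∈ T.edgeSet := by
    intro e he
    rw [Walk.edges_mapLe_eq_edges] at he
    exact q.edges_subset_edgeSet he
  have hqp : (q.mapLe hTG).IsPath := (Walk.isPath_mapLe hTG).2 hq
  by_cases hqR : ∃ r ∈ q.edges, r ∈ R
  · obtain ⟨r, hrq, hrR⟩ := hqR
    refine ⟨q.mapLe hTG, hqp, exists_unique_color_of_forall hqp (f := r)
      (by rwa [Walk.edges_mapLe_eq_edges]) fun g hg hgr => ?_⟩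
    rw [(hc1 r).2 (Or.inr hrR), hc1] at hgr
    exact hR (hgr.resolve_left fun h => h (hqT g hg)) hrR
  push Not at hqR
  by_cases hqb : ∃ e ∈ q.edges, ¬ G.IsBridge e
  · obtain ⟨e, heq, heb⟩ := hqb
    obtain ⟨p, hp, f, hfp, hfT, huniq⟩ := hT.exists_isPath_unique_notMem hG hTG hq heq heb
    refine ⟨p, hp, exists_unique_color_of_forall hp hfp fun g hg hgf => ?_⟩
    rw [(hc1 f).2 (Or.inl hfT), hc1] at hgf
    rcases hgf with h | h
    · exact huniq g hg h
    · have hreach : (G.deleteEdges {g}).Reachable u v := by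
        refine ⟨(q.mapLe hTG).toDeleteEdges {g} fun e he => ?_⟩
        rw [Walk.edges_mapLe_eq_edges] at he
        rintro rfl
        exact hqR _ he h
      exact absurd hg ((hRb g h).notMem_edges_of_reachable hreach hp.isTrail)
  push Not at hqb
  have hlen : q.length = 1 := by
    cases q with
    | nil => exact absurd rfl huv
    | @cons _ x _ h q =>
      cases q with
      | nil => rfl
      | @cons _ y _ h' q =>
        exfalso
        have h1 : s(x, u) ∈ (Walk.cons h (Walk.cons h' q)).edges := by simp [Sym2.eq_swap]
        have h2 : s(x, y) ∈ (Walk.cons h (Walk.cons h' q)).edges := by simp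
        have := hmatch x u y (hqb _ h1) (hqb _ h2) (hqR _ h1) (hqR _ h2)
        subst this
        simp at hq
  refine ⟨q.mapLe hTG, hqp, 0, ?_⟩
  rw [Walk.edges_mapLe_eq_edges, List.filter_eq_self.2, Walk.length_edges, hlen]
  intro e he
  simpa [hc0] using ⟨q.edges_subset_edgeSet he, hqR e he⟩

/-- Deleting bridges from a connected graph produces at least one new component per bridge. -/
theorem card_lt_card_connectedComponent_deleteEdges {V : Type*} [Finite V] {G : SimpleGraph V}
    [Nonempty V] (S : Finset (Sym2 V)) (hS : ∀ e ∈ S, G.IsBridge e)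
    (hSG : ∀ e ∈ S, e ∈ G.edgeSet) :
    S.card < Nat.card (G.deleteEdges (S : Set (Sym2 V))).ConnectedComponent := by
  classical
  induction S using Finset.induction_on with
  | empty => simp
  | insert e S heS ih =>
    rw [Finset.card_insert_of_notMem heS]
    refine (Nat.succ_le_of_lt (ih (fun f hf => hS f (Finset.mem_insert_of_mem hf))
      fun f hf => hSG f (Finset.mem_insert_of_mem hf))).trans_lt ?_
    have hle : G.deleteEdges ((insert e S : Finset _) : Set (Sym2 V)) ≤
        G.deleteEdges (S : Set (Sym2 V)) := deleteEdges_anti (by simp)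
    have heb := hS e (Finset.mem_insert_self e S)
    have heG := hSG e (Finset.mem_insert_self e S)
    induction e with | h a b
    have := Fintype.ofFinite (G.deleteEdges (S : Set (Sym2 V))).ConnectedComponent
    have := Fintype.ofFinite
      (G.deleteEdges ((insert s(a, b) S : Finset _) : Set (Sym2 V))).ConnectedComponent
    rw [Nat.card_eq_fintype_card, Nat.card_eq_fintype_card]
    refine Fintype.card_lt_of_surjective_not_injective
      (ConnectedComponent.map (Hom.ofLE hle)) ?_ ?_
    · exact ConnectedComponent.surjective_map_ofLE hle
    · intro hinj
      have hab : (G.deleteEdges (S : Set (Sym2 V))).Adj a b := by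
        simp only [deleteEdges_adj, Finset.mem_coe]
        exact ⟨heG, heS⟩
      have := @hinj (connectedComponentMk _ a) (connectedComponentMk _ b)
        (ConnectedComponent.eq.2 hab.reachable)
      refine heb ((ConnectedComponent.eq.1 this).mono (deleteEdges_anti ?_))
      simp

/-- When all degrees are at least `D ≥ 5`, deleting at most four bridges leaves only components
with more than `D` vertices. -/
theorem lt_card_component_deleteEdges {V : Type*} [Fintype V] [DecidableEq V] {G : SimpleGraph V}
    [DecidableRel G.Adj] {D : ℕ} (hD : 5 ≤ D) (hdeg : ∀ v, D ≤ G.degree v)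
    (S : Finset (Sym2 V)) (hS : ∀ e ∈ S, G.IsBridge e) (hcard : S.card ≤ 4)
    (K : Finset V) (hK : K.Nonempty)
    (hKr : ∀ v ∈ K, ∀ w, w ∈ K ↔ (G.deleteEdges (S : Set (Sym2 V))).Reachable v w) :
    D < K.card := by
  by_contra! hlt
  have hinc : ∀ v ∈ K, D ≤ (K.card - 1) + (S.filter (v ∈ ·)).card := by
    intro v hv
    have hsub : G.neighborFinset v ⊆ K.erase v ∪ Finset.univ.filter (fun w => s(v, w) ∈ S) := by
      intro w hw
      rw [mem_neighborFinset] at hw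
      by_cases hs : s(v, w) ∈ S
      · simp [hs]
      · have hadj : (G.deleteEdges (S : Set (Sym2 V))).Adj v w := by
          simp only [deleteEdges_adj, Finset.mem_coe]
          exact ⟨hw, hs⟩
        simp [hw.ne', (hKr v hv w).2 hadj.reachable]
    have hinj : (Finset.univ.filter (fun w => s(v, w) ∈ S)).card ≤
        (S.filter (v ∈ ·)).card := by
      refine Finset.card_le_card_of_injOn (fun w => s(v, w)) (fun w hw => ?_) ?_
      · simpa using hw
      · intro a _ b _ hab
        exact Sym2.congr_right.1 hab
    calc D ≤ (G.neighborFinset v).card := by simpa using hdeg v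
      _ ≤ (K.erase v).card + _ := (Finset.card_le_card hsub).trans (Finset.card_union_le _ _)
      _ ≤ _ := by rw [Finset.card_erase_of_mem hv]; gcongr
  have hsum : ∑ v ∈ K, (S.filter (v ∈ ·)).card ≤ 4 := by
    calc ∑ v ∈ K, (S.filter (v ∈ ·)).card = ∑ e ∈ S, (K.filter (· ∈ e)).card :=
          Finset.sum_card_bipartiteAbove_eq_sum_card_bipartiteBelow (fun v e => v ∈ e)
      _ ≤ ∑ e ∈ S, 1 := by
          refine Finset.sum_le_sum fun e he => Finset.card_le_one.2 fun a ha b hb => ?_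
          rw [Finset.mem_filter] at ha hb
          by_contra hab
          obtain rfl := (Sym2.mem_and_mem_iff hab).1 ⟨ha.2, hb.2⟩
          exact hS _ he (((hKr a ha.1 b).1 hb.1).mono (deleteEdges_anti (by simpa using he)))
      _ ≤ 4 := by simpa using hcard
  have htotal : K.card * D ≤ K.card * (K.card - 1) + 4 := by
    calc K.card * D = ∑ v ∈ K, D := by simp
      _ ≤ ∑ v ∈ K, ((K.card - 1) + (S.filter (v ∈ ·)).card) := Finset.sum_le_sum hinc
      _ ≤ _ := by rw [Finset.sum_add_distrib]; simpa using hsum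
  obtain ⟨k, hk⟩ : ∃ k, K.card = k + 1 := ⟨K.card - 1, by have := hK.card_pos; omega⟩
  rw [hk] at htotal hlt
  obtain ⟨m, rfl⟩ := Nat.exists_eq_add_of_le hlt
  simp only [Nat.add_sub_cancel] at htotal
  nlinarith [Nat.zero_le (k * m)]

/-- A connected graph on at most `5 D + 4` vertices with all degrees at least `D ≥ 5` has at most
three bridges. -/
theorem card_le_three_of_isBridge {V : Type*} [Fintype V] {G : SimpleGraph V}
    (hG : G.Connected) {D : ℕ} (hD : 5 ≤ D) (hdeg : ∀ v, D ≤ vdeg G v)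
    (hn : Fintype.card V ≤ 5 * D + 4) (B : Finset (Sym2 V)) (hB : ∀ e ∈ B, G.IsBridge e) :
    B.card ≤ 3 := by
  classical
  by_contra! hlt
  obtain ⟨S, hSB, hS4⟩ := Finset.exists_subset_card_eq (Nat.succ_le_of_lt hlt)
  have hSb : ∀ e ∈ S, G.IsBridge e := fun e he => hB e (hSB he)
  have := hG.nonempty
  set H := G.deleteEdges (S : Set (Sym2 V)) with hH
  have hcomp := card_lt_card_connectedComponent_deleteEdges S hSb
    fun e he => (hSb e he).mem_edgeSet_of_connected hG
  have := Fintype.ofFinite H.ConnectedComponent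
  rw [← hH, Nat.card_eq_fintype_card] at hcomp
  have hdeg' : ∀ v, D ≤ G.degree v := fun v => by
    have := hdeg v
    rwa [vdeg, ← coe_neighborFinset, Set.ncard_coe_finset, card_neighborFinset_eq_degree] at this
  have hfib : ∀ C : H.ConnectedComponent,
      D + 1 ≤ (Finset.univ.filter fun v => H.connectedComponentMk v = C).card := by
    intro C
    refine lt_card_component_deleteEdges hD hdeg' S hSb hS4.le _ ?_ ?_
    · obtain ⟨v, rfl⟩ := C.exists_rep
      exact ⟨v, by simp; rfl⟩
    · intro v hv w
      obtain rfl := (Finset.mem_filter.1 hv).2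
      simp only [Finset.mem_filter, Finset.mem_univ, true_and, ConnectedComponent.eq]
      exact ⟨Reachable.symm, Reachable.symm⟩
  have hsum : Fintype.card V = ∑ C : H.ConnectedComponent,
      (Finset.univ.filter fun v => H.connectedComponentMk v = C).card :=
    Finset.card_eq_sum_card_fiberwise (by simp)
  have hge : Fintype.card H.ConnectedComponent * (D + 1) ≤ Fintype.card V := by
    rw [hsum]
    calc _ = ∑ C : H.ConnectedComponent, (D + 1) := by simp
      _ ≤ _ := Finset.sum_le_sum fun C _ => hfib C
  have : 5 * (D + 1) ≤ Fintype.card H.ConnectedComponent * (D + 1) :=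
    Nat.mul_le_mul_right _ (by omega)
  omega

/-- In a connected graph whose bridges, at most three in number, form a linear forest, at most one
bridge has to be removed for the remaining ones to form a matching. -/
theorem exists_isBridge_matching {V : Type*} [Finite V] {G : SimpleGraph V}
    (hlf : IsLinearForest (bridgeGraph G))
    (hB : ∀ B : Finset (Sym2 V), (∀ e ∈ B, G.IsBridge e) → B.card ≤ 3) :
    ∃ R : Set (Sym2 V), (∀ r ∈ R, G.IsBridge r) ∧ R.Subsingleton ∧
      ∀ v a b, G.IsBridge s(v, a) → G.IsBridge s(v, b) → s(v, a) ∉ R → s(v, b) ∉ R → a = b := by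
  classical
  have hne : ∀ {x y : V}, G.IsBridge s(x, y) → x ≠ y := by
    rintro x y h rfl
    exact h (Reachable.refl x)
  have hstar : ∀ {v a b c : V}, G.IsBridge s(v, a) → G.IsBridge s(v, b) → G.IsBridge s(v, c) →
      a ≠ b → a ≠ c → b ≠ c → False := by
    intro v a b c ha hb hc hab hac hbc
    have hsub : (({a, b, c} : Finset V) : Set V) ⊆ (bridgeGraph G).neighborSet v := by
      intro x hx
      have hx : x = a ∨ x = b ∨ x = c := by simpa using hx
      have hbx : G.IsBridge s(v, x) := by rcases hx with rfl | rfl | rfl <;> assumption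
      simpa [bridgeGraph] using ⟨hbx, hne hbx⟩
    have := (Set.ncard_le_ncard hsub (Set.toFinite _)).trans (hlf.2 v)
    rw [Set.ncard_coe_finset, Finset.card_eq_three.2 ⟨a, b, c, hab, hac, hbc, rfl⟩] at this
    omega
  have htri : ∀ {v a b : V}, G.IsBridge s(v, a) → G.IsBridge s(v, b) → G.IsBridge s(a, b) →
      False := by
    intro v a b ha hb hab
    have hadj : ∀ {x y : V}, G.IsBridge s(x, y) → (bridgeGraph G).Adj x y := fun h => by
      simpa [bridgeGraph] using ⟨h, hne h⟩
    have hbr := isAcyclic_iff_forall_isBridge.1 hlf.1 (e := s(a, b)) (hadj hab)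
    refine hbr (Reachable.trans (v := v) (Adj.reachable ?_) (Adj.reachable ?_))
    · simp only [deleteEdges_adj, Set.mem_singleton_iff]
      refine ⟨(hadj ha).symm, fun h => ?_⟩
      exact hne hb (Sym2.congr_right.1 h)
    · simp only [deleteEdges_adj, Set.mem_singleton_iff]
      refine ⟨hadj hb, fun h => ?_⟩
      exact hne ha (Sym2.congr_left.1 h)
  by_contra! hcon
  obtain ⟨v, a, b, ha, hb, -, -, hab⟩ := hcon ∅ (by simp) (by simp)
  have hab' : s(v, a) ≠ s(v, b) := fun h => hab (Sym2.congr_right.1 h)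
  obtain ⟨w, x, y, hx, hy, hxr, hyr, hxy⟩ := hcon {s(v, a)} (by simpa using ha) (by simp)
  obtain ⟨w', x', y', hx', hy', hxr', hyr', hxy'⟩ := hcon {s(v, b)} (by simpa using hb) (by simp)
  have hxy2 : s(w, x) ≠ s(w, y) := fun h => hxy (Sym2.congr_right.1 h)
  have hxy2' : s(w', x') ≠ s(w', y') := fun h => hxy' (Sym2.congr_right.1 h)
  simp only [Set.mem_singleton_iff] at hxr hyr hxr' hyr'
  /- There is exactly one further bridge `k`, and it meets both of the given ones. -/
  obtain ⟨k, hk, hka, hkb, hall⟩ : ∃ k, G.IsBridge k ∧ k ≠ s(v, a) ∧ k ≠ s(v, b) ∧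
      ∀ e, G.IsBridge e → e = s(v, a) ∨ e = s(v, b) ∨ e = k := by
    obtain ⟨k, hk, hka, hkb⟩ : ∃ k, G.IsBridge k ∧ k ≠ s(v, a) ∧ k ≠ s(v, b) := by
      by_cases h : s(w, x) = s(v, b)
      · exact ⟨_, hy, hyr, fun h' => hxy2 (h.trans h'.symm)⟩
      · exact ⟨_, hx, hxr, h⟩
    refine ⟨k, hk, hka, hkb, fun e he => ?_⟩
    by_contra! hne'
    have := hB {s(v, a), s(v, b), k, e} (by simp [ha, hb, hk, he])
    rw [Finset.card_insert_of_notMem, Finset.card_eq_three.2 ⟨_, _, _, hkb.symm, hne'.2.1.symm,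
      hne'.2.2.symm, rfl⟩] at this
    · omega
    · simp [hab', hka.symm, hne'.1.symm, -Sym2.eq]
  have hwk : w ∈ k ∧ w ∈ s(v, b) := by
    have h1 := (hall _ hx).resolve_left hxr
    have h2 := (hall _ hy).resolve_left hyr
    rcases h1 with h1 | h1 <;> rcases h2 with h2 | h2
    · exact absurd (h1.trans h2.symm) hxy2
    · exact ⟨h2 ▸ Sym2.mem_mk_left _ _, h1 ▸ Sym2.mem_mk_left _ _⟩
    · exact ⟨h1 ▸ Sym2.mem_mk_left _ _, h2 ▸ Sym2.mem_mk_left _ _⟩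
    · exact absurd (h1.trans h2.symm) hxy2
  have hwk' : w' ∈ k ∧ w' ∈ s(v, a) := by
    have h1 := (hall _ hx').imp_right fun h => h.resolve_left hxr'
    have h2 := (hall _ hy').imp_right fun h => h.resolve_left hyr'
    rcases h1 with h1 | h1 <;> rcases h2 with h2 | h2
    · exact absurd (h1.trans h2.symm) hxy2'
    · exact ⟨h2 ▸ Sym2.mem_mk_left _ _, h1 ▸ Sym2.mem_mk_left _ _⟩
    · exact ⟨h1 ▸ Sym2.mem_mk_left _ _, h2 ▸ Sym2.mem_mk_left _ _⟩
    · exact absurd (h1.trans h2.symm) hxy2'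
  by_cases hvk : v ∈ k
  · obtain ⟨z, rfl⟩ := hvk
    exact hstar ha hb hk hab (fun h => hka (h ▸ rfl)) (fun h => hkb (h ▸ rfl))
  · have hbk : b ∈ k := (Sym2.mem_iff.1 hwk.2).elim (fun h => absurd (h ▸ hwk.1) hvk)
      fun h => h ▸ hwk.1
    have hak : a ∈ k := (Sym2.mem_iff.1 hwk'.2).elim (fun h => absurd (h ▸ hwk'.1) hvk)
      fun h => h ▸ hwk'.1
    obtain rfl := (Sym2.mem_and_mem_iff hab).1 ⟨hak, hbk⟩
    exact htri ha hb hk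

/-- A graph with a conflict-free connected coloring by at most one color is complete. -/
theorem eq_top_of_isCFConnected {V : Type*} {G : SimpleGraph V} {c : Sym2 V → ℕ}
    (hc : ∀ e ∈ G.edgeSet, c e = 0) (h : IsCFConnected G c) : G = ⊤ := by
  ext u v
  rw [top_adj]
  refine ⟨Adj.ne, fun huv => ?_⟩
  obtain ⟨p, -, col, hcol⟩ := h u v huv
  rw [List.filter_congr (q := fun _ => decide (0 = col))
    fun e he => by rw [hc e (p.edges_subset_edgeSet he)]] at hcol
  by_cases h0 : 0 = col
  · simp only [h0, decide_true, List.filter_true, Walk.length_edges] at hcol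
    exact Walk.adj_of_length_eq_one hcol
  · simp [h0] at hcol

theorem stmt_12 {V : Type*} [Fintype V] (G : SimpleGraph V)
    (hn : 25 ≤ Fintype.card V) (hG : G.Connected) (hnc : G ≠ ⊤)
    (hlf : IsLinearForest (bridgeGraph G))
    (hδ : ∀ v, ((Fintype.card V : ℚ) - 4) / 5 ≤ (vdeg G v : ℚ)) :
    cfcNum G = 2 := by
  have hdeg : ∀ v, (Fintype.card V) / 5 ≤ vdeg G v ∧ Fintype.card V ≤ 5 * vdeg G v + 4 := by
    intro v
    have h : (Fintype.card V : ℚ) ≤ 5 * vdeg G v + 4 := by linarith [hδ v]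
    have h' : Fintype.card V ≤ 5 * vdeg G v + 4 := by exact_mod_cast h
    omega
  obtain ⟨R, hRb, hR, hmatch⟩ := exists_isBridge_matching hlf fun B hB =>
    card_le_three_of_isBridge hG (D := Fintype.card V / 5) (by omega) (fun v => (hdeg v).1)
      (by omega) B hB
  obtain ⟨c, hc, hcf⟩ := exists_two_coloring_of_bridges hG hRb hR hmatch
  have hmem : 2 ∈ {k | ∃ c : Sym2 V → ℕ, (∀ e ∈ G.edgeSet, c e < k) ∧ IsCFConnected G c} :=
    ⟨c, fun e _ => hc e, hcf⟩
  refine le_antisymm (Nat.sInf_le hmem) (le_csInf ⟨2, hmem⟩ ?_)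
  rintro k ⟨c, hc, hcf⟩
  by_contra! hk
  exact hnc (eq_top_of_isCFConnected (fun e he => by have := hc e he; omega) hcf)
end

section
/- Let G be a connected non-complete graph of order n with 9 ≤ n ≤ 24 such that the subgraph induced by the cut edges of G is a linear forest. If δ(G) ≥ max{3, (n−4)/5}, then cfc(G) = 2. -/
open SimpleGraph

namespace SimpleGraph

theorem Walk.IsPath.append_of_inter {V : Type*} {G : SimpleGraph V} {u w v : V}
    {p : G.Walk u w} {q : G.Walk w v} (hp : p.IsPath) (hq : q.IsPath)
    (h : ∀ x ∈ p.support, x ∈ q.support → x = w) : (p.append q).IsPath := by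
  rw [Walk.isPath_def, Walk.support_append, List.nodup_append]
  have hq' := hq.support_nodup
  rw [← Walk.cons_tail_support, List.nodup_cons] at hq'
  refine ⟨hp.support_nodup, hq'.2, ?_⟩
  rintro x hx y hy rfl
  have := h x hx (List.mem_of_mem_tail hy)
  exact hq'.1 (this ▸ hy)

theorem Walk.IsPath.eq_of_mem_append {V : Type*} {G : SimpleGraph V} {u w v x : V}
    {p : G.Walk u w} {q : G.Walk w v} (h : (p.append q).IsPath)
    (hp : x ∈ p.support) (hq : x ∈ q.support) : x = w := by
  rw [Walk.isPath_def, Walk.support_append, List.nodup_append] at h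
  rw [← Walk.cons_tail_support, List.mem_cons] at hq
  rcases hq with hq | hq
  · exact hq
  · exact absurd rfl (h.2.2 x hp x hq)

/-- A walk ending in `D` can be cut down to a path that stops as soon as it meets `D`. -/
theorem Walk.exists_isPath_first_hit {V : Type*} {G : SimpleGraph V} (D : Set V) {u v : V}
    (q : G.Walk u v) (hv : v ∈ D) :
    ∃ x ∈ D, ∃ p : G.Walk u x, p.IsPath ∧ p.support ⊆ q.support ∧
      ∀ t ∈ p.support, t ∈ D → t = x := by
  classical
  suffices h : ∃ x ∈ D, ∃ p : G.Walk u x, p.support ⊆ q.support ∧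
      ∀ t ∈ p.support, t ∈ D → t = x by
    obtain ⟨x, hx, p, hp, ht⟩ := h
    exact ⟨x, hx, p.bypass, p.bypass_isPath, fun t h => hp (p.support_bypass_subset_support h),
      fun t h => ht t (p.support_bypass_subset_support h)⟩
  induction q with
  | nil => exact ⟨_, hv, .nil, by simp, by simp⟩
  | @cons a b c h q ih =>
    by_cases ha : a ∈ D
    · exact ⟨a, ha, .nil, by simp, by simp⟩
    · obtain ⟨x, hx, p, hp, ht⟩ := ih hv
      refine ⟨x, hx, .cons h p, ?_, ?_⟩
      · rw [Walk.support_cons, Walk.support_cons]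
        exact List.cons_subset_cons _ hp
      · intro t
        rw [Walk.support_cons, List.mem_cons]
        rintro (rfl | h1) h2
        · exact absurd h2 ha
        · exact ht t h1 h2

/-- If `q` avoids `w`, a path through `e` ending at a neighbor of `w` can be rerouted to end
at `w`. -/
theorem Walk.IsPath.exists_isPath_mem_edges_of_adj {V : Type*} {G : SimpleGraph V} {e : Sym2 V}
    {u v w : V} {p : G.Walk u v} (hp : p.IsPath) (he : e ∈ p.edges) (h : G.Adj v w)
    (q : G.Walk u v) (hq : w ∉ q.support) :
    ∃ p' : G.Walk u w, p'.IsPath ∧ e ∈ p'.edges := by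
  classical
  by_cases hw : w ∈ p.support
  · have hspec := p.take_spec hw
    rw [← hspec, Walk.edges_append, List.mem_append] at he
    rcases he with he | he
    · exact ⟨_, hp.takeUntil hw, he⟩
    set d := p.dropUntil w hw
    have hd : d.IsPath := hp.dropUntil hw
    obtain ⟨x, hx, r, hr, hrq, hrd⟩ :=
      q.exists_isPath_first_hit {t | t ∈ d.support} d.end_mem_support
    have hxd : x ∈ d.support := hx
    have hxw : w ≠ x := fun hh => hq (hrq (hh ▸ r.end_mem_support))
    have hds := d.take_spec hxd
    rw [← hds, Walk.edges_append, List.mem_append] at he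
    rcases he with he | he
    · refine ⟨r.append (d.takeUntil x hxd).reverse, ?_, ?_⟩
      · refine hr.append_of_inter (hd.takeUntil hxd).reverse fun t h1 h2 => hrd t h1 ?_
        rw [Walk.support_reverse, List.mem_reverse] at h2
        exact d.support_takeUntil_subset_support hxd h2
      · rw [Walk.edges_append, List.mem_append, Walk.edges_reverse, List.mem_reverse]
        exact .inr he
    · have hwd : w ∉ (d.dropUntil x hxd).support := fun hh =>
        hxw (Walk.IsPath.eq_of_mem_append (hds.symm ▸ hd)
          (d.takeUntil x hxd).start_mem_support hh)
      refine ⟨r.append ((d.dropUntil x hxd).concat h), ?_, ?_⟩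
      · refine hr.append_of_inter ((hd.dropUntil hxd).concat hwd h) fun t h1 h2 => ?_
        rw [Walk.support_concat, List.mem_append, List.mem_singleton] at h2
        rcases h2 with h2 | rfl
        · exact hrd t h1 (d.support_dropUntil_subset_support hxd h2)
        · exact absurd (hrq h1) hq
      · rw [Walk.edges_append, List.mem_append, Walk.edges_concat, List.concat_eq_append,
          List.mem_append]
        exact .inr (.inl he)
  · refine ⟨p.concat h, hp.concat hw h, ?_⟩
    rw [Walk.edges_concat, List.concat_eq_append, List.mem_append]
    exact .inl he

/-- No vertex of `G` separates two non-isolated vertices. -/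
def IsNonseparable {V : Type*} (G : SimpleGraph V) : Prop :=
  ∀ w x y, x ≠ w → y ≠ w → x ∈ G.support → y ∈ G.support → ∃ q : G.Walk x y, w ∉ q.support

theorem IsNonseparable.exists_isPath_mem_edges {V : Type*} {G : SimpleGraph V}
    (hG : G.IsNonseparable) {a b u v : V} (hab : G.Adj a b) (hu : u ∈ G.support)
    (hv : v ∈ G.support) (huv : u ≠ v) : ∃ p : G.Walk u v, p.IsPath ∧ s(a, b) ∈ p.edges := by
  classical
  have start : ∃ v₀, v₀ ≠ u ∧ ∃ p : G.Walk u v₀, p.IsPath ∧ s(a, b) ∈ p.edges := by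
    by_cases hub : u = b
    · subst hub
      exact ⟨a, hab.ne, .cons hab.symm .nil, by simp [hab.ne'], by simp [Sym2.eq_swap]⟩
    · obtain ⟨q, hq⟩ := hG b u a hub hab.ne hu hab.left_mem_support
      refine ⟨b, Ne.symm hub, q.bypass.concat hab,
        q.bypass_isPath.concat (fun h => hq (q.support_bypass_subset_support h)) hab, ?_⟩
      rw [Walk.edges_concat]
      simp
  obtain ⟨v₀, hv₀, p, hp, he⟩ := start
  have hp0 : ¬ p.Nil := fun h => hv₀ h.eq.symm
  have hv₀s : v₀ ∈ G.support := (p.adj_penultimate hp0).right_mem_support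
  obtain ⟨q, hq⟩ := hG u v₀ v hv₀ huv.symm hv₀s hv
  clear hp0 hv₀ hv₀s hv huv
  induction q with
  | nil => exact ⟨p, hp, he⟩
  | @cons x y z h q ih =>
    rw [Walk.support_cons, List.mem_cons, not_or] at hq
    have hyu : u ≠ y := fun hh => hq.2 (hh ▸ q.start_mem_support)
    obtain ⟨r, hr⟩ := hG y u x hyu h.ne hu h.left_mem_support
    obtain ⟨p', hp', he'⟩ := hp.exists_isPath_mem_edges_of_adj he h r hr
    exact ih p' hp' he' hq.2

theorem Reachable.mem_support_of_ne {V : Type*} {G : SimpleGraph V} {u v : V}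
    (h : G.Reachable u v) (huv : u ≠ v) : u ∈ G.support := by
  obtain ⟨p⟩ := h
  cases p with
  | nil => exact absurd rfl huv
  | cons h _ => exact h.left_mem_support

theorem reachable_sup_of_support_inter {V : Type*} {G H : SimpleGraph V} {w : V}
    (hw : ∀ x ∈ G.support, x ∈ H.support → x = w) {u v : V} (h : (G ⊔ H).Reachable u v) :
    G.Reachable u v ∨ H.Reachable u v ∨ (G.Reachable u w ∧ H.Reachable w v) ∨
      (H.Reachable u w ∧ G.Reachable w v) := by
  have key : ∀ {G H : SimpleGraph V}, (∀ x ∈ G.support, x ∈ H.support → x = w) →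
      ∀ {u x v : V}, G.Adj u x → (G.Reachable x v ∨ H.Reachable x v ∨
        (G.Reachable x w ∧ H.Reachable w v) ∨ (H.Reachable x w ∧ G.Reachable w v)) →
      (G.Reachable u v ∨ H.Reachable u v ∨ (G.Reachable u w ∧ H.Reachable w v) ∨
        (H.Reachable u w ∧ G.Reachable w v)) := by
    intro G H hw u x v hux hx
    rcases hx with hx | hx | ⟨h1, h2⟩ | ⟨h1, h2⟩
    · exact .inl (hux.reachable.trans hx)
    · by_cases hxv : x = v
      · exact .inl (hxv ▸ hux.reachable)
      · have := hw x hux.right_mem_support (hx.mem_support_of_ne hxv)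
        subst this
        exact .inr (.inr (.inl ⟨hux.reachable, hx⟩))
    · exact .inr (.inr (.inl ⟨hux.reachable.trans h1, h2⟩))
    · by_cases hxw : x = w
      · exact .inl (hux.reachable.trans (hxw ▸ h2))
      · exact absurd (hw x hux.right_mem_support (h1.mem_support_of_ne hxw)) hxw
  obtain ⟨p⟩ := h
  induction p with
  | nil => exact .inl .rfl
  | cons h p ih =>
    rcases h with h | h
    · exact key hw h ih
    · have := key (fun x h1 h2 => hw x h2 h1) h
        (by tauto : H.Reachable _ _ ∨ G.Reachable _ _ ∨ _ ∨ _)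
      tauto

theorem notMem_edgeSet_of_support_inter {V : Type*} {G H : SimpleGraph V} {w : V}
    (hw : ∀ x ∈ G.support, x ∈ H.support → x = w) {e : Sym2 V} (he : e ∈ G.edgeSet) :
    e ∉ H.edgeSet := by
  induction e with
  | _ a b =>
    intro he'
    rw [mem_edgeSet] at he he'
    exact he.ne ((hw a he.left_mem_support he'.left_mem_support).trans
      (hw b he.right_mem_support he'.right_mem_support).symm)

theorem IsBridge.sup_of_support_inter {V : Type*} {G H : SimpleGraph V} {w : V}
    (hw : ∀ x ∈ G.support, x ∈ H.support → x = w) {e : Sym2 V} (he : e ∈ G.edgeSet)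
    (hb : G.IsBridge e) : (G ⊔ H).IsBridge e := by
  induction e with
  | _ a b =>
    rw [isBridge_iff] at hb ⊢
    intro h
    have hle : (G ⊔ H).deleteEdges {s(a, b)} ≤ G.deleteEdges {s(a, b)} ⊔ H := by
      intro x y hxy
      simp only [deleteEdges_adj, sup_adj] at hxy ⊢
      tauto
    rw [mem_edgeSet] at he
    have hG' : ∀ x ∈ (G.deleteEdges {s(a, b)}).support, x ∈ H.support → x = w :=
      fun x hx => hw x (support_mono (deleteEdges_le _) hx)
    rcases reachable_sup_of_support_inter hG' (h.mono hle) with h | h | ⟨h1, h2⟩ | ⟨h1, h2⟩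
    · exact hb h
    · exact he.ne ((hw a he.left_mem_support (h.mem_support_of_ne he.ne)).trans
        (hw b he.right_mem_support (h.symm.mem_support_of_ne he.ne')).symm)
    · by_cases hbw : b = w
      · exact hb (hbw ▸ h1)
      · exact hbw (hw b he.right_mem_support (h2.symm.mem_support_of_ne hbw))
    · by_cases haw : a = w
      · exact hb (haw ▸ h2)
      · exact haw (hw a he.left_mem_support (h1.mem_support_of_ne haw))

theorem exists_isPath_append_of_support_inter {V : Type*} {G H : SimpleGraph V} {w : V}
    (hw : ∀ x ∈ G.support, x ∈ H.support → x = w) {u v : V} {p : G.Walk u w} {q : H.Walk w v}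
    (hp : p.IsPath) (hq : q.IsPath) :
    ∃ r : (G ⊔ H).Walk u v, r.IsPath ∧ ∀ e, e ∈ r.edges ↔ e ∈ p.edges ∨ e ∈ q.edges := by
  refine ⟨(p.mapLe le_sup_left).append (q.mapLe le_sup_right), ?_, ?_⟩
  · refine (hp.mapLe _).append_of_inter (hq.mapLe _) fun x h1 h2 => ?_
    rw [Walk.support_mapLe_eq_support] at h1 h2
    by_cases hpn : p.Nil
    · have := hpn.eq
      subst this
      simpa [Walk.nil_iff_support_eq.mp hpn] using h1
    by_cases hqn : q.Nil
    · have := hqn.eq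
      subst this
      simpa [Walk.nil_iff_support_eq.mp hqn] using h2
    exact hw x (mem_support_of_mem_walk_support p hpn h1)
      (mem_support_of_mem_walk_support q hqn h2)
  · intro e
    rw [Walk.edges_append, List.mem_append, Walk.edges_mapLe_eq_edges, Walk.edges_mapLe_eq_edges]

theorem exists_sup_of_not_isNonseparable {V : Type*} {G : SimpleGraph V}
    (hG : ¬ G.IsNonseparable) :
    ∃ (H₁ H₂ : SimpleGraph V) (w : V), H₁ < G ∧ H₂ < G ∧ G = H₁ ⊔ H₂ ∧
      ∀ x ∈ H₁.support, x ∈ H₂.support → x = w := by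
  simp only [IsNonseparable, not_forall, not_exists, not_not] at hG
  obtain ⟨w, x, y, hxw, hyw, ⟨x', hx'⟩, ⟨y', hy'⟩, hq⟩ := hG
  let K : Set V := {z | ∃ q : G.Walk x z, w ∉ q.support}
  have hK : ∀ {a b : V}, a ∈ K → G.Adj a b → b ≠ w → b ∈ K := by
    rintro a b ⟨q, hq⟩ hab hbw
    refine ⟨q.concat hab, ?_⟩
    rw [Walk.support_concat, List.mem_append, List.mem_singleton]
    rintro (h | h)
    · exact hq h
    · exact hbw h.symm
  have hxK : x ∈ K := ⟨.nil, by simpa using hxw.symm⟩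
  have hyK : y ∉ K := fun ⟨q, h⟩ => h (hq q)
  let H₁ : SimpleGraph V :=
    { Adj := fun a b => G.Adj a b ∧ (a ∈ K ∨ b ∈ K)
      symm := ⟨fun a b h => ⟨h.1.symm, h.2.symm⟩⟩
      loopless := ⟨fun a h => G.loopless.irrefl a h.1⟩ }
  let H₂ : SimpleGraph V :=
    { Adj := fun a b => G.Adj a b ∧ ¬ (a ∈ K ∨ b ∈ K)
      symm := ⟨fun a b h => ⟨h.1.symm, fun h' => h.2 h'.symm⟩⟩
      loopless := ⟨fun a h => G.loopless.irrefl a h.1⟩ }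
  have h1 : ∀ {a b}, H₁.Adj a b ↔ G.Adj a b ∧ (a ∈ K ∨ b ∈ K) := Iff.rfl
  have h2 : ∀ {a b}, H₂.Adj a b ↔ G.Adj a b ∧ ¬ (a ∈ K ∨ b ∈ K) := Iff.rfl
  refine ⟨H₁, H₂, w, lt_of_le_not_ge (fun a b h => h.1) fun hle => ?_,
    lt_of_le_not_ge (fun a b h => h.1) fun hle => ?_, ?_, ?_⟩
  · rcases (hle hy').2 with h | h
    · exact hyK h
    · exact hyK (hK h hy'.symm hyw)
  · exact (hle hx').2 (.inl hxK)
  · ext a b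
    rw [sup_adj, h1, h2]
    tauto
  · rintro t ⟨a, ha⟩ ⟨b, hb⟩
    by_contra htw
    replace ha := h1.mp ha
    replace hb := h2.mp hb
    rcases ha.2 with h | h
    · exact hb.2 (.inl h)
    · exact hb.2 (.inl (hK h ha.1.symm htw))

/-- Every finite graph has a set `S` of edges, meeting every nontrivial block in one edge, such
that deleting `S` preserves reachability, while any two mutually reachable vertices are joined by a
path that contains exactly one edge of `S` or consists of bridges only. -/
theorem exists_edgeSet_forall_exists_isPath {V : Type*} [Finite V] (G : SimpleGraph V) :
    ∃ S ⊆ G.edgeSet, (∀ u v, G.Reachable u v → ∃ p : G.Walk u v, p.IsPath ∧ ∀ e ∈ p.edges, e ∉ S) ∧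
      ∀ u v, u ≠ v → G.Reachable u v → ∃ p : G.Walk u v, p.IsPath ∧
        ((∃ e ∈ S, e ∈ p.edges ∧ ∀ e' ∈ p.edges, e' ∈ S → e' = e) ∨
          ∀ e ∈ p.edges, G.IsBridge e) := by
  classical
  induction G using WellFoundedLT.induction with
  | ind G ih =>
  by_cases hG : G.IsNonseparable
  · by_cases hbr : ∀ e ∈ G.edgeSet, G.IsBridge e
    · refine ⟨∅, by simp, ?_, ?_⟩
      · rintro u v ⟨p⟩
        exact ⟨p.bypass, p.bypass_isPath, by simp⟩
      · rintro u v - ⟨p⟩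
        exact ⟨p.bypass, p.bypass_isPath, .inr fun e he => hbr e (Walk.edges_subset_edgeSet _ he)⟩
    · push Not at hbr
      obtain ⟨e, he, heb⟩ := hbr
      induction e with
      | _ a b =>
      rw [isBridge_iff_forall_walk_mem_edges] at heb
      push Not at heb
      obtain ⟨q, hq⟩ := heb
      refine ⟨{s(a, b)}, by simpa using he, ?_, ?_⟩
      · rintro u v huv
        have hd : (G.deleteEdges {s(a, b)}).Reachable u v := by
          have hab : (G.deleteEdges {s(a, b)}).Reachable a b :=
            reachable_deleteEdges_iff_exists_walk.mpr ⟨q, hq⟩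
          obtain ⟨p⟩ := huv
          induction p with
          | nil => exact .rfl
          | @cons x y z h p ih =>
            refine Reachable.trans ?_ ih
            by_cases hxy : s(x, y) = s(a, b)
            · rcases Sym2.eq_iff.mp hxy with ⟨rfl, rfl⟩ | ⟨rfl, rfl⟩
              · exact hab
              · exact hab.symm
            · exact Adj.reachable (by simpa [deleteEdges_adj, h] using hxy)
        obtain ⟨p, hp⟩ := reachable_deleteEdges_iff_exists_walk.mp hd
        refine ⟨p.bypass, p.bypass_isPath, fun e he => ?_⟩
        rintro rfl
        exact hp (p.edges_bypass_subset_edges he)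
      · intro u v huv hr
        obtain ⟨p, hp, hep⟩ := hG.exists_isPath_mem_edges he (hr.mem_support_of_ne huv)
          (hr.symm.mem_support_of_ne huv.symm) huv
        exact ⟨p, hp, .inl ⟨_, rfl, hep, fun e' _ h => h⟩⟩
  · obtain ⟨H₁, H₂, w, hlt₁, hlt₂, rfl, hw⟩ := exists_sup_of_not_isNonseparable hG
    have hw' : ∀ x ∈ H₂.support, x ∈ H₁.support → x = w := fun x h1 h2 => hw x h2 h1
    obtain ⟨S₁, hS₁, hav₁, hone₁⟩ := ih H₁ hlt₁
    obtain ⟨S₂, hS₂, hav₂, hone₂⟩ := ih H₂ hlt₂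
    have hn₁ : ∀ {u v : V} {p : H₁.Walk u v}, ∀ e ∈ p.edges, e ∉ S₂ := fun {_ _ p} e he h =>
      notMem_edgeSet_of_support_inter hw (p.edges_subset_edgeSet he) (hS₂ h)
    have hn₂ : ∀ {u v : V} {p : H₂.Walk u v}, ∀ e ∈ p.edges, e ∉ S₁ := fun {_ _ p} e he h =>
      notMem_edgeSet_of_support_inter hw' (p.edges_subset_edgeSet he) (hS₁ h)
    have hb₁ : ∀ {u v : V} {p : H₁.Walk u v}, (∀ e ∈ p.edges, H₁.IsBridge e) →
        ∀ e ∈ p.edges, (H₁ ⊔ H₂).IsBridge e := fun {_ _ p} h e he =>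
      (h e he).sup_of_support_inter hw (p.edges_subset_edgeSet he)
    have hb₂ : ∀ {u v : V} {p : H₂.Walk u v}, (∀ e ∈ p.edges, H₂.IsBridge e) →
        ∀ e ∈ p.edges, (H₁ ⊔ H₂).IsBridge e := fun {_ _ p} h e he =>
      sup_comm H₂ H₁ ▸ (h e he).sup_of_support_inter hw' (p.edges_subset_edgeSet he)
    have hone₁' : ∀ {u v : V}, u ≠ v → H₁.Reachable u v → ∃ p : (H₁ ⊔ H₂).Walk u v, p.IsPath ∧
        ((∃ e ∈ S₁ ∪ S₂, e ∈ p.edges ∧ ∀ e' ∈ p.edges, e' ∈ S₁ ∪ S₂ → e' = e) ∨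
          ∀ e ∈ p.edges, (H₁ ⊔ H₂).IsBridge e) := by
      intro u v huv h
      obtain ⟨p, hp, h⟩ := hone₁ u v huv h
      refine ⟨p.mapLe le_sup_left, hp.mapLe _, ?_⟩
      rw [Walk.edges_mapLe_eq_edges]
      rcases h with ⟨e, he, hep, hu⟩ | h
      · exact .inl ⟨e, .inl he, hep, fun e' h1 h2 => hu e' h1 (h2.resolve_right (hn₁ e' h1))⟩
      · exact .inr (hb₁ h)
    have hone₂' : ∀ {u v : V}, u ≠ v → H₂.Reachable u v → ∃ p : (H₁ ⊔ H₂).Walk u v, p.IsPath ∧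
        ((∃ e ∈ S₁ ∪ S₂, e ∈ p.edges ∧ ∀ e' ∈ p.edges, e' ∈ S₁ ∪ S₂ → e' = e) ∨
          ∀ e ∈ p.edges, (H₁ ⊔ H₂).IsBridge e) := by
      intro u v huv h
      obtain ⟨p, hp, h⟩ := hone₂ u v huv h
      refine ⟨p.mapLe le_sup_right, hp.mapLe _, ?_⟩
      rw [Walk.edges_mapLe_eq_edges]
      rcases h with ⟨e, he, hep, hu⟩ | h
      · exact .inl ⟨e, .inr he, hep, fun e' h1 h2 => hu e' h1 (h2.resolve_left (hn₂ e' h1))⟩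
      · exact .inr (hb₂ h)
    have hav' : ∀ {u v : V}, H₁.Reachable u w → H₂.Reachable w v →
        ∃ p : (H₁ ⊔ H₂).Walk u v, p.IsPath ∧ ∀ e ∈ p.edges, e ∉ S₁ ∪ S₂ := by
      intro u v h1 h2
      obtain ⟨p, hp, hpS⟩ := hav₁ _ _ h1
      obtain ⟨q, hq, hqS⟩ := hav₂ _ _ h2
      obtain ⟨r, hr, hre⟩ := exists_isPath_append_of_support_inter hw hp hq
      refine ⟨r, hr, fun e he => ?_⟩
      rcases (hre e).mp he with he | he
      · exact fun h => h.elim (hpS e he) (hn₁ e he)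
      · exact fun h => h.elim (hn₂ e he) (hqS e he)
    have hone' : ∀ {u v : V}, u ≠ v → H₁.Reachable u w → H₂.Reachable w v →
        ∃ p : (H₁ ⊔ H₂).Walk u v, p.IsPath ∧
        ((∃ e ∈ S₁ ∪ S₂, e ∈ p.edges ∧ ∀ e' ∈ p.edges, e' ∈ S₁ ∪ S₂ → e' = e) ∨
          ∀ e ∈ p.edges, (H₁ ⊔ H₂).IsBridge e) := by
      intro u v huv h1 h2
      by_cases huw : u = w
      · exact hone₂' huv (huw ▸ h2)
      by_cases hwv : w = v
      · exact hone₁' huv (hwv ▸ h1)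
      obtain ⟨p, hp, hpS⟩ := hone₁ _ _ huw h1
      obtain ⟨q, hq, hqS⟩ := hone₂ _ _ hwv h2
      rcases hpS with ⟨e, he, hep, hu⟩ | hpb
      · obtain ⟨q, hq, hqS⟩ := hav₂ _ _ h2
        obtain ⟨r, hr, hre⟩ := exists_isPath_append_of_support_inter hw hp hq
        refine ⟨r, hr, .inl ⟨e, .inl he, (hre e).mpr (.inl hep), fun e' h3 h4 => ?_⟩⟩
        rcases (hre e').mp h3 with h3 | h3
        · exact hu e' h3 (h4.resolve_right (hn₁ e' h3))
        · exact absurd (h4.resolve_left (hn₂ e' h3)) (hqS e' h3)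
      rcases hqS with ⟨e, he, heq, hu⟩ | hqb
      · obtain ⟨p, hp, hpS⟩ := hav₁ _ _ h1
        obtain ⟨r, hr, hre⟩ := exists_isPath_append_of_support_inter hw hp hq
        refine ⟨r, hr, .inl ⟨e, .inr he, (hre e).mpr (.inr heq), fun e' h3 h4 => ?_⟩⟩
        rcases (hre e').mp h3 with h3 | h3
        · exact absurd (h4.resolve_right (hn₁ e' h3)) (hpS e' h3)
        · exact hu e' h3 (h4.resolve_left (hn₂ e' h3))
      · obtain ⟨r, hr, hre⟩ := exists_isPath_append_of_support_inter hw hp hq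
        exact ⟨r, hr, .inr fun e he => ((hre e).mp he).elim (hb₁ hpb e) (hb₂ hqb e)⟩
    refine ⟨S₁ ∪ S₂, ?_, ?_, ?_⟩
    · rw [edgeSet_sup]
      exact Set.union_subset_union hS₁ hS₂
    · intro u v huv
      rcases reachable_sup_of_support_inter hw huv with h | h | ⟨h1, h2⟩ | ⟨h1, h2⟩
      · obtain ⟨p, hp, hpS⟩ := hav₁ _ _ h
        refine ⟨p.mapLe le_sup_left, hp.mapLe _, fun e he => ?_⟩
        rw [Walk.edges_mapLe_eq_edges] at he
        exact fun h => h.elim (hpS e he) (hn₁ e he)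
      · obtain ⟨p, hp, hpS⟩ := hav₂ _ _ h
        refine ⟨p.mapLe le_sup_right, hp.mapLe _, fun e he => ?_⟩
        rw [Walk.edges_mapLe_eq_edges] at he
        exact fun h => h.elim (hn₂ e he) (hpS e he)
      · exact hav' h1 h2
      · obtain ⟨p, hp, hpS⟩ := hav' h2.symm h1.symm
        exact ⟨p.reverse, hp.reverse, by simpa using hpS⟩
    · intro u v hne huv
      rcases reachable_sup_of_support_inter hw huv with h | h | ⟨h1, h2⟩ | ⟨h1, h2⟩
      · exact hone₁' hne h
      · exact hone₂' hne h
      · exact hone' hne h1 h2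
      · obtain ⟨p, hp, h⟩ := hone' hne.symm h2.symm h1.symm
        exact ⟨p.reverse, hp.reverse, by simpa only [Walk.edges_reverse, List.mem_reverse] using h⟩

theorem card_add_one_le_card_connectedComponent_deleteEdges {V : Type*} [Finite V] [Nonempty V]
    (G : SimpleGraph V) (F : Finset (Sym2 V)) (hF : ∀ e ∈ F, e ∈ G.edgeSet ∧ G.IsBridge e) :
    F.card + 1 ≤ Nat.card (G.deleteEdges (F : Set (Sym2 V))).ConnectedComponent := by
  classical
  induction F using Finset.induction_on with
  | empty =>
    rw [Finset.card_empty, Nat.zero_add]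
    exact Nat.succ_le_of_lt Nat.card_pos
  | insert e F he ih =>
    have ih := ih fun e h => hF e (Finset.mem_insert_of_mem h)
    rw [Finset.card_insert_of_notMem he]
    refine (Nat.succ_le_succ ih).trans ?_
    obtain ⟨heG, heb⟩ := hF e (Finset.mem_insert_self _ _)
    have hle : G.deleteEdges (insert e F : Finset (Sym2 V)) ≤ G.deleteEdges (F : Set (Sym2 V)) :=
      deleteEdges_anti (by simp)
    let φ := ConnectedComponent.map (Hom.ofLE hle)
    have := Fintype.ofFinite (G.deleteEdges (insert e F : Finset (Sym2 V))).ConnectedComponent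
    have := Fintype.ofFinite (G.deleteEdges (F : Set (Sym2 V))).ConnectedComponent
    rw [Nat.card_eq_fintype_card, Nat.card_eq_fintype_card]
    refine Fintype.card_lt_of_surjective_not_injective φ ?_ ?_
    · intro c
      induction c using ConnectedComponent.ind with
      | _ v => exact ⟨connectedComponentMk _ v, rfl⟩
    · intro hinj
      induction e with
      | _ a b =>
      have h : φ (connectedComponentMk _ a) = φ (connectedComponentMk _ b) := by
        refine ConnectedComponent.sound (Adj.reachable ?_)
        rw [deleteEdges_adj]
        exact ⟨heG, by simpa using he⟩
      have h := ConnectedComponent.exact (hinj h)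
      exact heb (h.mono (deleteEdges_anti (by simp)))

theorem not_reachable_deleteEdges_of_isBridge {V : Type*} {G : SimpleGraph V} {F : Set (Sym2 V)}
    {p a b x y : V} (hpa : G.IsBridge s(p, a)) (hpb : G.IsBridge s(p, b)) (hb : G.Adj p b)
    (hab : a ≠ b) (hpaF : s(p, a) ∈ F) (hpbF : s(p, b) ∈ F)
    (hx : x = p ∨ x = a ∨ x = b) (hy : y = p ∨ y = a ∨ y = b) (hxy : x ≠ y) :
    ¬ (G.deleteEdges F).Reachable x y := by
  have h1 : ¬ (G.deleteEdges F).Reachable p a := fun h =>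
    hpa (h.mono (deleteEdges_anti (by simpa using hpaF)))
  have h2 : ¬ (G.deleteEdges F).Reachable p b := fun h =>
    hpb (h.mono (deleteEdges_anti (by simpa using hpbF)))
  have h3 : ¬ (G.deleteEdges F).Reachable b a := fun h => by
    refine hpa (Reachable.trans (Adj.reachable ?_)
      (h.mono (deleteEdges_anti (by simpa using hpaF))))
    rw [deleteEdges_adj]
    refine ⟨hb, fun h => hab ?_⟩
    exact (Sym2.congr_right.mp h).symm
  have h1' := fun h => h1 (Reachable.symm h)
  have h2' := fun h => h2 (Reachable.symm h)
  have h3' := fun h => h3 (Reachable.symm h)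
  rcases hx with rfl | rfl | rfl <;> rcases hy with rfl | rfl | rfl <;>
    first | exact absurd rfl hxy | assumption

/-- An edge that is not a bridge lies on a cycle, so either of its ends is incident to another
edge which is not a bridge. -/
theorem exists_adj_ne_not_isBridge {V : Type*} {G : SimpleGraph V} {c d : V} (hcd : G.Adj c d)
    (hb : ¬ G.IsBridge s(c, d)) : ∃ d', d' ≠ d ∧ G.Adj c d' ∧ ¬ G.IsBridge s(c, d') := by
  classical
  rw [isBridge_iff_forall_walk_mem_edges] at hb
  push Not at hb
  obtain ⟨q, hq⟩ := hb
  have hq : s(c, d) ∉ q.bypass.edges := fun h => hq (q.edges_bypass_subset_edges h)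
  have hp := q.bypass_isPath
  revert hp hq
  generalize q.bypass = p
  intro hq hp
  cases p with
  | nil => exact absurd rfl hcd.ne
  | @cons _ d' _ h p =>
    rw [Walk.cons_isPath_iff] at hp
    rw [Walk.edges_cons, List.mem_cons, not_or] at hq
    refine ⟨d', fun hh => hq.1 (by rw [hh]), h, ?_⟩
    rw [isBridge_iff_forall_walk_mem_edges]
    push Not
    refine ⟨.cons hcd p.reverse, ?_⟩
    rw [Walk.edges_cons, List.mem_cons, not_or, Walk.edges_reverse, List.mem_reverse]
    exact ⟨fun hh => hq.1 hh.symm, fun hh => hp.2 (p.fst_mem_support_of_mem_edges hh)⟩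

end SimpleGraph

theorem bridgeGraph_adj {V : Type*} {G : SimpleGraph V} (hG : G.Connected) {a b : V} :
    (bridgeGraph G).Adj a b ↔ G.Adj a b ∧ G.IsBridge s(a, b) := by
  rw [bridgeGraph, fromEdgeSet_adj]
  constructor
  · rintro ⟨h, -⟩
    exact ⟨(IsBridge.reachable_iff_adj h).mp (hG a b), h⟩
  · rintro ⟨h1, h2⟩
    exact ⟨h2, h1.ne⟩

/-- If `G` has large minimum degree, then two vertices incident to two cut edges each are joined by
a cut edge: otherwise deleting the four cut edges leaves five large components. -/
theorem bridgeGraph_adj_of_two_of_two {V : Type*} [Fintype V] {G : SimpleGraph V}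
    (hG : G.Connected) (hB : ∀ v, ((bridgeGraph G).neighborSet v).ncard ≤ 2)
    (h3 : ∀ v, 3 ≤ vdeg G v) (h5 : ∀ v, Fintype.card V < 5 * (vdeg G v + 1))
    {p p₁ p₂ q q₁ q₂ : V} (hpq : p ≠ q) (hp₁ : (bridgeGraph G).Adj p p₁)
    (hp₂ : (bridgeGraph G).Adj p p₂) (hp : p₁ ≠ p₂) (hq₁ : (bridgeGraph G).Adj q q₁)
    (hq₂ : (bridgeGraph G).Adj q q₂) (hq : q₁ ≠ q₂) : (bridgeGraph G).Adj p q := by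
  classical
  by_contra hnpq
  let F : Finset (Sym2 V) := {s(p, p₁), s(p, p₂), s(q, q₁), s(q, q₂)}
  have hF : ∀ {e}, e ∈ F ↔ e = s(p, p₁) ∨ e = s(p, p₂) ∨ e = s(q, q₁) ∨ e = s(q, q₂) := by
    intro e
    simp [F]
  have hp₁q : p₁ ≠ q := by rintro rfl; exact hnpq hp₁
  have hp₂q : p₂ ≠ q := by rintro rfl; exact hnpq hp₂
  have hcard : F.card = 4 := by
    simp only [F]
    repeat rw [Finset.card_insert_of_notMem]
    · simp
    all_goals simp only [Finset.mem_insert, Finset.mem_singleton, Sym2.eq_iff]; grind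
  have hb₁ := (bridgeGraph_adj hG).mp hp₁
  have hb₂ := (bridgeGraph_adj hG).mp hp₂
  have hb₃ := (bridgeGraph_adj hG).mp hq₁
  have hb₄ := (bridgeGraph_adj hG).mp hq₂
  have hFb : ∀ e ∈ F, e ∈ G.edgeSet ∧ G.IsBridge e := by
    intro e he
    rcases hF.mp he with rfl | rfl | rfl | rfl
    exacts [hb₁, hb₂, hb₃, hb₄]
  have : Nonempty V := ⟨p⟩
  have hcc := card_add_one_le_card_connectedComponent_deleteEdges G F hFb
  set H := G.deleteEdges (F : Set (Sym2 V)) with hH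
  have hHadj : ∀ {a b}, G.Adj a b → s(a, b) ∉ F → H.Adj a b := by
    intro a b h h'
    rw [hH, deleteEdges_adj]
    exact ⟨h, h'⟩
  have hfree : ∀ c : V, ∃ v, H.Reachable c v ∧ ∀ u, s(v, u) ∉ F := by
    intro c
    by_contra! hall
    have hmem : ∀ v, H.Reachable c v →
        (v = p ∨ v = p₁ ∨ v = p₂) ∨ (v = q ∨ v = q₁ ∨ v = q₂) := by
      intro v hv
      obtain ⟨u, hu⟩ := hall v hv
      simp only [hF, Sym2.eq_iff] at hu
      tauto
    obtain ⟨d, hd, hdb⟩ : ∃ d, G.Adj c d ∧ ¬ G.IsBridge s(c, d) := by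
      by_contra! hcon
      have hle : vdeg G c ≤ ((bridgeGraph G).neighborSet c).ncard :=
        Set.ncard_le_ncard (fun d hd => (bridgeGraph_adj hG).mpr ⟨hd, hcon d hd⟩)
          (Set.toFinite _)
      have := h3 c
      have := hB c
      omega
    obtain ⟨d', hdd', hd', hdb'⟩ := exists_adj_ne_not_isBridge hd hdb
    have hr : H.Reachable c d := (hHadj hd fun h => hdb (hFb _ h).2).reachable
    have hr' : H.Reachable c d' := (hHadj hd' fun h => hdb' (hFb _ h).2).reachable
    have hP : ∀ {x y : V}, (x = p ∨ x = p₁ ∨ x = p₂) → (y = p ∨ y = p₁ ∨ y = p₂) → x ≠ y →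
        ¬ H.Reachable x y := fun hx hy => not_reachable_deleteEdges_of_isBridge hb₁.2 hb₂.2 hb₂.1
      hp (hF.mpr (by simp)) (hF.mpr (by simp)) hx hy
    have hQ : ∀ {x y : V}, (x = q ∨ x = q₁ ∨ x = q₂) → (y = q ∨ y = q₁ ∨ y = q₂) → x ≠ y →
        ¬ H.Reachable x y := fun hx hy => not_reachable_deleteEdges_of_isBridge hb₃.2 hb₄.2 hb₄.1
      hq (hF.mpr (by simp)) (hF.mpr (by simp)) hx hy
    have hr'' : H.Reachable d d' := hr.symm.trans hr'
    rcases hmem c .rfl with h1 | h1 <;> rcases hmem d hr with h2 | h2 <;>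
      rcases hmem d' hr' with h3 | h3
    · exact hP h1 h2 hd.ne hr
    · exact hP h1 h2 hd.ne hr
    · exact hP h1 h3 hd'.ne hr'
    · exact hQ h2 h3 hdd'.symm hr''
    · exact hP h2 h3 hdd'.symm hr''
    · exact hQ h1 h3 hd'.ne hr'
    · exact hQ h1 h2 hd.ne hr
    · exact hQ h1 h2 hd.ne hr
  have := Fintype.ofFinite H.ConnectedComponent
  rw [hcard, Nat.card_eq_fintype_card] at hcc
  have hlt : Fintype.card V < Fintype.card H.ConnectedComponent * (Fintype.card V / 5 + 1) := by
    have : 5 * (Fintype.card V / 5 + 1) ≤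
        Fintype.card H.ConnectedComponent * (Fintype.card V / 5 + 1) :=
      Nat.mul_le_mul_right _ hcc
    omega
  obtain ⟨C, hC⟩ :=
    Fintype.exists_card_fiber_lt_of_card_lt_mul (f := H.connectedComponentMk) hlt
  induction C using ConnectedComponent.ind with
  | _ c =>
  obtain ⟨v, hcv, hv⟩ := hfree c
  have hsub : insert v (G.neighborSet v) ⊆
      (Finset.univ.filter fun x => H.connectedComponentMk x = H.connectedComponentMk c :
        Finset V) := by
    intro x hx
    rw [Finset.coe_filter, Set.mem_ofPred_eq]
    refine ⟨Finset.mem_univ _, ConnectedComponent.sound ?_⟩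
    rcases hx with rfl | hx
    · exact hcv.symm
    · exact ((hHadj hx (hv x)).symm.reachable).trans hcv.symm
  have hle := Set.ncard_le_ncard hsub (Finset.finite_toSet _)
  rw [Set.ncard_coe_finset, Set.ncard_insert_of_notMem (by simp) (Set.toFinite _)] at hle
  have hh : vdeg G v + 1 ≤ _ := hle
  have := h5 v
  omega

theorem exists_forall_bridgeGraph_adj_eq {V : Type*} [Fintype V] {G : SimpleGraph V}
    (hG : G.Connected) (hB : ∀ v, ((bridgeGraph G).neighborSet v).ncard ≤ 2)
    (h3 : ∀ v, 3 ≤ vdeg G v) (h5 : ∀ v, Fintype.card V < 5 * (vdeg G v + 1)) :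
    ∃ f : Sym2 V, ∀ v x y, (bridgeGraph G).Adj v x → (bridgeGraph G).Adj v y →
      s(v, x) ≠ f → s(v, y) ≠ f → x = y := by
  classical
  have hthree : ∀ {v x y z : V}, (bridgeGraph G).Adj v x → (bridgeGraph G).Adj v y →
      (bridgeGraph G).Adj v z → x ≠ y → z = x ∨ z = y := by
    intro v x y z hx hy hz hxy
    by_contra! hcon
    have hle : ({x, y, z} : Set V).ncard ≤ ((bridgeGraph G).neighborSet v).ncard := by
      refine Set.ncard_le_ncard ?_ (Set.toFinite _)
      rintro t (rfl | rfl | rfl) <;> assumption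
    rw [Set.ncard_eq_three.mpr ⟨x, y, z, hxy, hcon.1.symm, hcon.2.symm, rfl⟩] at hle
    have := hB v
    omega
  by_contra! hcon
  obtain ⟨v₀⟩ := hG.nonempty
  obtain ⟨v, x, y, hvx, hvy, -, -, hxy⟩ := hcon s(v₀, v₀)
  have key : ∀ {x y : V}, (bridgeGraph G).Adj v x → (bridgeGraph G).Adj v y → x ≠ y →
      ∃ a b, (bridgeGraph G).Adj y a ∧ (bridgeGraph G).Adj y b ∧ a ≠ b := by
    intro x y hvx hvy hxy
    obtain ⟨w, a, b, hwa, hwb, hae, hbe, hab⟩ := hcon s(v, x)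
    have hwv : w ≠ v := by
      rintro rfl
      rcases hthree hwa hwb hvx hab with h | h
      · exact hae (by rw [h])
      · exact hbe (by rw [h])
    have hwx : w ≠ x := by
      rintro rfl
      rcases hthree hwa hwb hvx.symm hab with h | h
      · exact hae (by rw [h, Sym2.eq_swap])
      · exact hbe (by rw [h, Sym2.eq_swap])
    have hadj := bridgeGraph_adj_of_two_of_two hG hB h3 h5 hwv.symm hvx hvy hxy hwa hwb hab
    rcases hthree hvx hvy hadj hxy with h | h
    · exact absurd h hwx
    · exact ⟨a, b, h ▸ hwa, h ▸ hwb, hab⟩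
  obtain ⟨a, b, ha, hb, hab⟩ := key hvx hvy hxy
  obtain ⟨a', b', ha', hb', hab'⟩ := key hvy hvx hxy.symm
  have hadj := bridgeGraph_adj_of_two_of_two hG hB h3 h5 hxy ha' hb' hab' ha hb hab
  have hbr := ((bridgeGraph_adj hG).mp hadj).2
  rw [isBridge_iff_forall_walk_mem_edges] at hbr
  have := hbr (.cons ((bridgeGraph_adj hG).mp hvx).1.symm
    (.cons ((bridgeGraph_adj hG).mp hvy).1 .nil))
  simp [hxy, hvx.ne', hvy.ne'] at this

theorem SimpleGraph.IsBridge.mem_edges_of_isPath {V : Type*} {G : SimpleGraph V} {e : Sym2 V}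
    (he : G.IsBridge e) {u v : V} {p : G.Walk u v} (hp : p.IsPath) (hep : e ∈ p.edges)
    (q : G.Walk u v) : e ∈ q.edges := by
  have key : ∀ {u v : V} (p : G.Walk u v), p.IsPath → e ∈ p.edges →
      ¬ (G.deleteEdges {e}).Reachable u v := by
    intro u v p
    induction p with
    | nil => simp
    | @cons x y z h p ih =>
      intro hp hep hr
      rw [Walk.cons_isPath_iff] at hp
      rw [Walk.edges_cons, List.mem_cons] at hep
      by_cases hxy : e = s(x, y)
      · subst hxy
        have h1 : (G.deleteEdges {s(x, y)}).Reachable y z :=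
          reachable_deleteEdges_iff_exists_walk.mpr
            ⟨p, fun hh => hp.2 (p.fst_mem_support_of_mem_edges hh)⟩
        exact he (hr.trans h1.symm)
      · refine ih hp.1 (hep.resolve_left hxy) (Reachable.trans (Adj.reachable ?_) hr)
        rw [deleteEdges_adj]
        exact ⟨h.symm, fun hh => hxy (by rw [Sym2.eq_swap]; exact hh.symm)⟩
  by_contra hq
  induction e with
  | _ a b => exact key p hp hep (reachable_deleteEdges_iff_exists_walk.mpr ⟨q, hq⟩)

theorem length_filter_eq_one {α : Type*} {l : List α} (hl : l.Nodup) {a : α} (ha : a ∈ l)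
    {P : α → Bool} (hP : ∀ b ∈ l, P b = true ↔ b = a) : (l.filter P).length = 1 := by
  classical
  have h : l.filter P = l.filter (· = a) := List.filter_congr fun b hb => by
    rw [Bool.eq_iff_iff, hP b hb, decide_eq_true_iff]
  rw [h, ← List.countP_eq_length_filter]
  rw [← List.count_eq_one_of_mem hl ha, List.count]
  exact List.countP_congr fun b _ => by simp

theorem exists_isCFConnected_of_forall_bridgeGraph_adj {V : Type*} [Finite V] {G : SimpleGraph V}
    (hG : G.Connected) {f : Sym2 V} (hf : ∀ v x y, (bridgeGraph G).Adj v x →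
      (bridgeGraph G).Adj v y → s(v, x) ≠ f → s(v, y) ≠ f → x = y) :
    ∃ c : Sym2 V → ℕ, (∀ e, c e < 2) ∧ IsCFConnected G c := by
  classical
  obtain ⟨S, hS, hav, hone⟩ := G.exists_edgeSet_forall_exists_isPath
  have hSb : ∀ e ∈ S, ¬ G.IsBridge e := by
    intro e
    induction e with
    | _ a b =>
      intro he hb
      obtain ⟨p, -, hp⟩ := hav a b (hG a b)
      exact hp _ (isBridge_iff_forall_walk_mem_edges.mp hb p) he
  refine ⟨fun e => if e ∈ S ∨ (e = f ∧ G.IsBridge e) then 1 else 0,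
    fun e => by dsimp only; split_ifs <;> omega, ?_⟩
  intro u v huv
  obtain ⟨p, hp, h⟩ := hone u v huv (hG u v)
  by_cases hfp : f ∈ p.edges ∧ G.IsBridge f
  · obtain ⟨q, hq, hqS⟩ := hav u v (hG u v)
    refine ⟨q, hq, 1, length_filter_eq_one hq.isTrail.edges_nodup
      (hfp.2.mem_edges_of_isPath hp hfp.1 q) fun b hb => ?_⟩
    have := hqS b hb
    simp only [this, false_or, decide_eq_true_iff]
    constructor
    · intro h
      by_contra hbf
      simp [hbf] at h
    · rintro rfl
      simp [hfp.2]
  have hne : ∀ b ∈ p.edges, ¬ (b = f ∧ G.IsBridge b) := by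
    rintro b hb ⟨rfl, h⟩
    exact hfp ⟨hb, h⟩
  rcases h with ⟨e, heS, hep, hu⟩ | h
  · refine ⟨p, hp, 1, length_filter_eq_one hp.isTrail.edges_nodup hep fun b hb => ?_⟩
    simp only [hne b hb, or_false, decide_eq_true_iff]
    constructor
    · intro h
      by_contra hbe
      have : b ∉ S := fun h => hbe (hu b hb h)
      simp [this] at h
    · rintro rfl
      simp [heS]
  · refine ⟨p, hp, 0, ?_⟩
    cases p with
    | nil => exact absurd rfl huv
    | @cons _ x _ hux p =>
      cases p with
      | nil =>
        have h1 := h s(u, v) (by simp)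
        have h2 : s(u, v) ∉ S := fun hh => hSb _ hh h1
        have h3 := hne s(u, v) (by simp)
        simp only [Walk.edges_cons, Walk.edges_nil]
        rw [List.filter_cons_of_pos (by simp only [h2, h3, or_self, if_false, decide_true])]
        simp
      | @cons _ y _ hxy p =>
        have h1 := h s(u, x) (by simp)
        have h2 := h s(x, y) (by simp)
        have h3 : s(x, u) ≠ f := fun hh =>
          hne s(u, x) (by simp) ⟨by rw [Sym2.eq_swap]; exact hh, h1⟩
        have h4 : s(x, y) ≠ f := fun hh => hne s(x, y) (by simp) ⟨hh, h2⟩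
        have := hf x u y ((bridgeGraph_adj hG).mpr ⟨hux, h1⟩).symm
          ((bridgeGraph_adj hG).mpr ⟨hxy, h2⟩) h3 h4
        subst this
        rw [Walk.cons_isPath_iff] at hp
        exact absurd (by simp) hp.2

theorem two_le_of_isCFConnected {V : Type*} {G : SimpleGraph V} (hne : G ≠ ⊤) {k : ℕ}
    {c : Sym2 V → ℕ} (hc : ∀ e ∈ G.edgeSet, c e < k) (h : IsCFConnected G c) : 2 ≤ k := by
  by_contra! hk
  refine hne (top_le_iff.mp fun u v huv => ?_)
  obtain ⟨p, -, col, hcol⟩ := h u v huv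
  have h0 : ∀ e ∈ p.edges, c e = 0 := fun e he => by
    have := hc e (p.edges_subset_edgeSet he)
    omega
  have hlen : p.length = 1 := by
    by_cases h : col = 0
    · rwa [List.filter_eq_self.mpr (by simpa [h] using h0), Walk.length_edges] at hcol
    · rw [List.filter_eq_nil_iff.mpr] at hcol
      · simp at hcol
      · intro e he
        simp [h0 e he, Ne.symm h]
  exact p.adj_of_length_eq_one hlen

theorem stmt_13 {V : Type*} [Fintype V] (G : SimpleGraph V)
    (hn1 : 9 ≤ Fintype.card V) (hn2 : Fintype.card V ≤ 24)
    (hG : G.Connected) (hnc : G ≠ ⊤)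
    (hlf : IsLinearForest (bridgeGraph G))
    (hδ : ∀ v, max (3 : ℚ) (((Fintype.card V : ℚ) - 4) / 5) ≤ (vdeg G v : ℚ)) :
    cfcNum G = 2 := by
  have h3 : ∀ v, 3 ≤ vdeg G v := fun v => by
    have := (le_max_left _ _).trans (hδ v)
    exact_mod_cast this
  have h5 : ∀ v, Fintype.card V < 5 * (vdeg G v + 1) := fun v => by
    have := (le_max_right _ _).trans (hδ v)
    rw [div_le_iff₀ (by norm_num), sub_le_iff_le_add] at this
    have : Fintype.card V ≤ vdeg G v * 5 + 4 := by exact_mod_cast this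
    omega
  obtain ⟨f, hf⟩ := exists_forall_bridgeGraph_adj_eq hG hlf.2 h3 h5
  obtain ⟨c, hc, hcf⟩ := exists_isCFConnected_of_forall_bridgeGraph_adj hG hf
  refine le_antisymm (Nat.sInf_le ⟨c, fun e _ => hc e, hcf⟩) ?_
  exact le_csInf ⟨2, c, fun e _ => hc e, hcf⟩ fun k ⟨c', hc', hcf'⟩ =>
    two_le_of_isCFConnected hnc hc' hcf'
end

section
/- Let G be a connected non-complete graph of order n ≥ 33 such that the subgraph induced by the cut edges of G is a linear forest. If deg(x)+deg(y) ≥ (2n−9)/5 for every pair of non-adjacent vertices x and y of G, then cfc(G) = 2. -/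
open SimpleGraph

namespace SimpleGraph

variable {V : Type*} {G : SimpleGraph V}

/-- A walk meeting `X` splits at its first vertex in `X`. -/
lemma Walk.exists_append_first_mem (X : Set V) {u v : V} (q : G.Walk u v)
    (h : ∃ z ∈ q.support, z ∈ X) :
    ∃ (x : V) (q₁ : G.Walk u x) (q₂ : G.Walk x v), x ∈ X ∧ q = q₁.append q₂ ∧
      ∀ z ∈ q₁.support, z ∈ X → z = x := by
  induction q with
  | nil =>
    obtain ⟨z, hz, hX⟩ := h
    rw [Walk.support_nil, List.mem_singleton] at hz
    subst hz
    exact ⟨z, Walk.nil, Walk.nil, hX, rfl, by simp⟩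
  | @cons u w v hadj q ih =>
    by_cases hu : u ∈ X
    · exact ⟨u, Walk.nil, Walk.cons hadj q, hu, rfl, by simp⟩
    · obtain ⟨x, q₁, q₂, hx, rfl, hq⟩ := ih <| by
        obtain ⟨z, hz, hX⟩ := h
        rw [Walk.support_cons, List.mem_cons] at hz
        rcases hz with rfl | hz
        · exact absurd hX hu
        · exact ⟨z, hz, hX⟩
      refine ⟨x, Walk.cons hadj q₁, q₂, hx, rfl, fun z hz hX ↦ ?_⟩
      rw [Walk.support_cons, List.mem_cons] at hz
      rcases hz with rfl | hz
      · exact absurd hX hu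
      · exact hq z hz hX

lemma Walk.IsPath.append_of_support_inter {u v w : V} {p : G.Walk u v} {q : G.Walk v w}
    (hp : p.IsPath) (hq : q.IsPath) (h : ∀ z ∈ p.support, z ∈ q.support → z = v) :
    (p.append q).IsPath := by
  rw [Walk.isPath_def, Walk.support_append, List.nodup_append]
  have hq' := hq.support_nodup
  rw [← Walk.cons_tail_support, List.nodup_cons] at hq'
  refine ⟨hp.support_nodup, hq'.2, ?_⟩
  rintro a ha _ hb rfl
  exact hq'.1 (h a ha (List.mem_of_mem_tail hb) ▸ hb)

/-- A path sharing an edge `f` with a cycle can be rerouted along either arc of the cycle: the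
arcs are edge-disjoint and replace the part of the path that contains `f`. -/
lemma Walk.IsPath.exists_reroute {u v w : V} {q : G.Walk u v} (hq : q.IsPath)
    {C : G.Walk w w} (hC : C.IsCycle) {f : Sym2 V} (hfq : f ∈ q.edges) (hfC : f ∈ C.edges) :
    ∃ (x y : V) (q₁ : G.Walk u x) (m A B : G.Walk x y) (q₂ : G.Walk y v),
      q = q₁.append (m.append q₂) ∧ f ∈ m.edges ∧
      (q₁.append (A.append q₂)).IsPath ∧ (q₁.append (B.append q₂)).IsPath ∧
      (A.edges ++ B.edges).Perm C.edges := by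
  classical
  have hend : ∀ {z}, z ∈ f → z ∈ C.support := fun hz ↦ C.mem_support_of_mem_edges hfC hz
  have hloop : ¬ f.IsDiag := G.not_isDiag_of_mem_edgeSet (C.edges_subset_edgeSet hfC)
  have hone : ∀ {a b : V} (r : G.Walk a b) (x : V),
      (∀ z ∈ r.support, z ∈ C.support → z = x) → f ∉ r.edges := by
    intro a b r x hr hfr
    induction f with | h s t =>
    have h₁ := hr s (r.fst_mem_support_of_mem_edges hfr) (hend (by simp))
    have h₂ := hr t (r.snd_mem_support_of_mem_edges hfr) (hend (by simp))
    exact hloop (by simp [h₁, h₂])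
  obtain ⟨x, q₁, r, hx, rfl, hq₁⟩ := q.exists_append_first_mem {z | z ∈ C.support} <| by
    induction f with | h s t =>
    exact ⟨s, q.fst_mem_support_of_mem_edges hfq, hend (by simp)⟩
  obtain ⟨y, s, m, hy, hr, hs⟩ := r.reverse.exists_append_first_mem {z | z ∈ C.support}
    ⟨x, by simp, hx⟩
  obtain rfl : r = m.reverse.append s.reverse := by
    rw [← Walk.reverse_append, ← hr, Walk.reverse_reverse]
  have hs' : ∀ z ∈ s.reverse.support, z ∈ C.support → z = y := fun z hz ↦ hs z (by simpa using hz)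
  have hfm : f ∈ m.reverse.edges := by
    rw [Walk.edges_append, Walk.edges_append, List.mem_append, List.mem_append] at hfq
    rcases hfq with h | h | h
    · exact absurd h (hone _ _ hq₁)
    · exact h
    · exact absurd h (hone _ _ hs')
  have hqr := hq.of_append_right
  have hxy : x ≠ y := by
    rintro rfl
    rw [(Walk.isPath_iff_nil.1 hqr.of_append_left).eq_nil] at hfm
    simp at hfm
  have hdisj : ∀ z ∈ q₁.support, z ∈ s.reverse.support → False := by
    intro z hz hz'
    have hnd := hq.support_nodup
    rw [Walk.support_append, List.nodup_append] at hnd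
    have hzr : z ∈ (m.reverse.append s.reverse).support := by
      rw [Walk.mem_support_append_iff]; exact Or.inr hz'
    rw [← Walk.cons_tail_support, List.mem_cons] at hzr
    rcases hzr with rfl | hzr
    · exact hxy (hs' z hz' hx)
    · exact hnd.2.2 z hz z hzr rfl
  have hpath : ∀ A : G.Walk x y, A.IsPath → (∀ z ∈ A.support, z ∈ C.support) →
      (q₁.append (A.append s.reverse)).IsPath := by
    intro A hA hAC
    refine hq.of_append_left.append_of_support_inter
      (hA.append_of_support_inter hqr.of_append_right fun z hz hz' ↦ hs' z hz' (hAC z hz)) ?_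
    intro z hz hz'
    rw [Walk.mem_support_append_iff] at hz'
    rcases hz' with hz' | hz'
    · exact hq₁ z hz (hAC z hz')
    · exact (hdisj z hz hz').elim
  have hx : x ∈ C.support := hx
  set D := C.rotate x hx with hD
  have hDc : D.IsCycle := (Walk.isCycle_rotate hx).2 hC
  have hDs : ∀ z, z ∈ D.support ↔ z ∈ C.support := fun z ↦ Walk.mem_support_rotate_iff ..
  have hyD : y ∈ D.support := (hDs y).2 hy
  have hspec := D.take_spec hyD
  refine ⟨x, y, q₁, m.reverse, D.takeUntil y hyD, (D.dropUntil y hyD).reverse, s.reverse, rfl, hfm,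
    hpath _ (hDc.isPath_takeUntil hyD)
      fun z hz ↦ (hDs z).1 (D.support_takeUntil_subset_support hyD hz),
    hpath _ ?_ ?_, ?_⟩
  · refine Walk.IsPath.reverse ?_
    refine Walk.IsCycle.isPath_of_append_right (p := D.takeUntil y hyD) ?_ (by rwa [hspec])
    intro hnil
    exact hxy hnil.eq
  · intro z hz
    rw [Walk.support_reverse, List.mem_reverse] at hz
    exact (hDs z).1 (D.support_dropUntil_subset_support hyD hz)
  · have h₁ : (D.takeUntil y hyD).edges ++ (D.dropUntil y hyD).edges = D.edges := by
      rw [← Walk.edges_append, hspec]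
    rw [Walk.edges_reverse]
    exact ((List.reverse_perm _).append_left _).trans (h₁ ▸ (C.rotate_edges x hx).perm)

lemma _root_.List.countP_eq_one_of_unique {α : Type*} {P : α → Bool} {l : List α}
    (hl : l.Nodup) {e : α} (he : e ∈ l) (hPe : P e) (h : ∀ f ∈ l, P f → f = e) :
    l.countP P = 1 := by
  classical
  rw [← List.count_eq_one_of_mem hl he, List.count]
  refine List.countP_congr fun f hf ↦ ⟨fun hP ↦ by simpa using h f hf hP, fun hfe ↦ ?_⟩
  rwa [eq_of_beq hfe]

/-- A path through an edge `f` of a cycle with exactly one marked edge can be rerouted so that the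
part containing `f` is replaced by an arc with no marked edge, or by one with a single one. -/
lemma Walk.IsPath.exists_countP_reroute (P : Sym2 V → Bool) {u v w : V} {q : G.Walk u v}
    (hq : q.IsPath) {C : G.Walk w w} (hC : C.IsCycle) (hCP : C.edges.countP P = 1)
    {f : Sym2 V} (hfq : f ∈ q.edges) (hfC : f ∈ C.edges) :
    ∃ (p₀ p₁ : G.Walk u v) (k m : ℕ), p₀.IsPath ∧ p₁.IsPath ∧ p₀.edges.countP P = k ∧
      p₁.edges.countP P = k + 1 ∧ q.edges.countP P = k + m ∧ (P f → 1 ≤ m) := by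
  obtain ⟨x, y, q₁, m, A, B, q₂, rfl, hfm, hA, hB, hAB⟩ := hq.exists_reroute hC hfq hfC
  have hsum : A.edges.countP P + B.edges.countP P = 1 := by
    rw [← List.countP_append, hAB.countP_eq, hCP]
  have hm : P f → 1 ≤ m.edges.countP P := fun hf ↦ List.countP_pos_iff.2 ⟨f, hfm, hf⟩
  rcases Nat.eq_zero_or_pos (A.edges.countP P) with h | h
  · refine ⟨_, _, q₁.edges.countP P + q₂.edges.countP P, m.edges.countP P, hA, hB, ?_, ?_, ?_, hm⟩ <;>
      simp only [Walk.edges_append, List.countP_append] <;> lia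
  · refine ⟨_, _, q₁.edges.countP P + q₂.edges.countP P, m.edges.countP P, hB, hA, ?_, ?_, ?_, hm⟩ <;>
      simp only [Walk.edges_append, List.countP_append] <;> lia

/-- In a finite graph one can mark non-bridges so that every marked edge is a non-bridge and every
non-bridge lies on a cycle with exactly one marked edge (for instance, mark one edge in each
block that is not a bridge). -/
lemma exists_marking [Finite V] (G : SimpleGraph V) :
    ∃ P : Sym2 V → Bool, (∀ e, P e → e ∈ G.edgeSet ∧ ¬ G.IsBridge e) ∧
      ∀ f ∈ G.edgeSet, ¬ G.IsBridge f →
        ∃ (w : V) (C : G.Walk w w), C.IsCycle ∧ C.edges.countP P = 1 ∧ f ∈ C.edges := by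
  classical
  let good : Set (Set (Sym2 V)) := {S | (∀ e ∈ S, e ∈ G.edgeSet ∧ ¬ G.IsBridge e) ∧
    ∀ (w : V) (C : G.Walk w w), C.IsCycle → ∀ e ∈ S, ∀ f ∈ S, e ∈ C.edges → f ∈ C.edges → e = f}
  obtain ⟨S, hS⟩ := (Set.toFinite good).exists_maximal ⟨∅, by simp [good]⟩
  refine ⟨fun e ↦ decide (e ∈ S), fun e he ↦ hS.prop.1 e (by simpa using he), fun f hf hfb ↦ ?_⟩
  have key : ∃ (w : V) (C : G.Walk w w), C.IsCycle ∧ f ∈ C.edges ∧ ∃ e ∈ S, e ∈ C.edges := by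
    by_contra hcon
    have hfS : f ∉ S := by
      intro hfS
      rw [isBridge_iff_forall_cycle_notMem hf] at hfb
      push Not at hfb
      obtain ⟨w, C, hC, hfC⟩ := hfb
      exact hcon ⟨w, C, hC, hfC, f, hfS, hfC⟩
    have hins : insert f S ∈ good := by
      refine ⟨?_, ?_⟩
      · rintro e (rfl | he)
        · exact ⟨hf, hfb⟩
        · exact hS.prop.1 e he
      · rintro w C hC e (rfl | he) e' (rfl | he') heC heC'
        · rfl
        · exact (hcon ⟨w, C, hC, heC, e', he', heC'⟩).elim
        · exact (hcon ⟨w, C, hC, heC', e, he, heC⟩).elim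
        · exact hS.prop.2 w C hC e he e' he' heC heC'
    exact hfS (hS.le_of_ge hins (Set.subset_insert f S) (Set.mem_insert f S))
  obtain ⟨w, C, hC, hfC, e, he, heC⟩ := key
  refine ⟨w, C, hC, ?_, hfC⟩
  exact List.countP_eq_one_of_unique hC.edges_nodup heC (by simpa using he)
    fun f hf hfS ↦ hS.prop.2 w C hC f (by simpa using hfS) e he hf heC

lemma Walk.IsPath.exists_isPath_countP_eq_zero {P : Sym2 V → Bool}
    (hP : ∀ e, P e → e ∈ G.edgeSet ∧ ¬ G.IsBridge e)
    (hcyc : ∀ f ∈ G.edgeSet, ¬ G.IsBridge f →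
      ∃ (w : V) (C : G.Walk w w), C.IsCycle ∧ C.edges.countP P = 1 ∧ f ∈ C.edges)
    {u v : V} {q : G.Walk u v} (hq : q.IsPath) :
    ∃ p : G.Walk u v, p.IsPath ∧ p.edges.countP P = 0 := by
  induction hn : q.edges.countP P using Nat.strong_induction_on generalizing q with
  | _ n ih =>
    rcases Nat.eq_zero_or_pos n with rfl | hpos
    · exact ⟨q, hq, hn⟩
    · obtain ⟨f, hfq, hf⟩ := List.countP_pos_iff.1 (hn ▸ hpos)
      obtain ⟨w, C, hC, hCP, hfC⟩ := hcyc f (hP f hf).1 (hP f hf).2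
      obtain ⟨p₀, p₁, k, m, h₀, -, hk, -, hkm, hm⟩ :=
        hq.exists_countP_reroute P hC hCP hfq hfC
      have := hm hf
      exact ih k (by lia) h₀ hk

lemma Walk.IsPath.exists_isPath_countP_eq_one {P : Sym2 V → Bool}
    (hP : ∀ e, P e → e ∈ G.edgeSet ∧ ¬ G.IsBridge e)
    (hcyc : ∀ f ∈ G.edgeSet, ¬ G.IsBridge f →
      ∃ (w : V) (C : G.Walk w w), C.IsCycle ∧ C.edges.countP P = 1 ∧ f ∈ C.edges)
    {u v : V} {q : G.Walk u v} (hq : q.IsPath) {f : Sym2 V}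
    (hfq : f ∈ q.edges) (hfb : ¬ G.IsBridge f) :
    ∃ p : G.Walk u v, p.IsPath ∧ p.edges.countP P = 1 := by
  obtain ⟨w, C, hC, hCP, hfC⟩ := hcyc f (q.edges_subset_edgeSet hfq) hfb
  obtain ⟨-, r, k, -, -, hr, -, hk, -⟩ := hq.exists_countP_reroute P hC hCP hfq hfC
  have hpos : 0 < r.edges.countP P := by lia
  clear hk
  induction hn : r.edges.countP P using Nat.strong_induction_on generalizing r with
  | _ n ih =>
    obtain ⟨f, hfr, hf⟩ := List.countP_pos_iff.1 hpos
    obtain ⟨w, C, hC, hCP, hfC⟩ := hcyc f (hP f hf).1 (hP f hf).2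
    obtain ⟨p₀, p₁, k, m, h₀, h₁, hk, hk', hkm, hm⟩ :=
      hr.exists_countP_reroute P hC hCP hfr hfC
    have := hm hf
    rcases Nat.eq_zero_or_pos k with rfl | hkpos
    · exact ⟨p₁, h₁, hk'⟩
    · exact ih k (by lia) p₀ h₀ (by lia) hk

/-- A bridge on some path between two vertices lies on every walk between them. -/
lemma IsBridge.mem_edges_of_isPath_s17 {b : Sym2 V} (hb : G.IsBridge b) {u v : V} {p : G.Walk u v}
    (hp : p.IsPath) (hbp : b ∈ p.edges) (q : G.Walk u v) : b ∈ q.edges := by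
  induction p with
  | nil => simp at hbp
  | @cons u w v h p ih =>
    rw [Walk.edges_cons, List.mem_cons] at hbp
    have hnd := hp.isTrail.edges_nodup
    rw [Walk.edges_cons, List.nodup_cons] at hnd
    rcases hbp with rfl | hbp
    · have := isBridge_iff_forall_walk_mem_edges.1 hb (q.append p.reverse)
      rw [Walk.edges_append, List.mem_append, Walk.edges_reverse, List.mem_reverse] at this
      exact this.resolve_right hnd.1
    · have := ih hp.of_cons hbp (Walk.cons h.symm q)
      rw [Walk.edges_cons, List.mem_cons] at this
      refine this.resolve_left ?_
      rintro rfl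
      exact hnd.1 (Sym2.eq_swap ▸ hbp)

end SimpleGraph

/-- If discarding at most one bridge leaves no two adjacent bridges, then two colors suffice. -/
lemma exists_isCFConnected {V : Type*} [Finite V] {G : SimpleGraph V} (hG : G.Connected)
    (b : Sym2 V) (hb : ∀ x y z : V, x ≠ z → G.IsBridge s(x, y) → G.IsBridge s(y, z) →
      s(x, y) = b ∨ s(y, z) = b) :
    ∃ c : Sym2 V → ℕ, (∀ e ∈ G.edgeSet, c e < 2) ∧ IsCFConnected G c := by
  classical
  obtain ⟨P, hP, hcyc⟩ := G.exists_marking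
  refine ⟨fun e ↦ if P e ∨ e = b ∧ G.IsBridge b then 1 else 0,
    fun e _ ↦ by dsimp only; split_ifs <;> simp, fun u v huv ↦ ?_⟩
  simp only [← List.countP_eq_length_filter]
  obtain ⟨q, hq⟩ := hG.exists_isPath u v
  obtain ⟨p, hp, hp0⟩ := hq.exists_isPath_countP_eq_zero hP hcyc
  have hpP : ∀ e ∈ p.edges, ¬ P e := List.countP_eq_zero.1 hp0
  by_cases hbp : b ∈ p.edges ∧ G.IsBridge b
  · refine ⟨p, hp, 1, List.countP_eq_one_of_unique hp.isTrail.edges_nodup hbp.1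
      (by simp [hbp.2]) fun f hf h ↦ ?_⟩
    have := hpP f hf
    simp_all
  by_cases hf : ∃ f ∈ p.edges, ¬ G.IsBridge f
  · obtain ⟨f, hfp, hfb⟩ := hf
    obtain ⟨r, hr, hr1⟩ := hp.exists_isPath_countP_eq_one hP hcyc hfp hfb
    refine ⟨r, hr, 1, (List.countP_congr fun e he ↦ ?_).trans hr1⟩
    have : ¬ (e = b ∧ G.IsBridge b) := by
      rintro ⟨rfl, hb'⟩
      exact hbp ⟨hb'.mem_edges_of_isPath_s17 hr he p, hb'⟩
    simp [this]
  · push Not at hf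
    refine ⟨p, hp, 0, ?_⟩
    match p with
    | .nil => exact absurd rfl huv
    | .cons h .nil =>
      have hS := hpP s(u, v) (by simp)
      have hB : ¬ (s(u, v) = b ∧ G.IsBridge b) := by
        rintro ⟨rfl, hb'⟩
        exact hbp ⟨by simp, hb'⟩
      simp [hS, hB]
    | .cons (v := y) h (.cons (v := z) h' p') =>
      exfalso
      have hmem : s(u, y) ∈ (Walk.cons h (.cons h' p')).edges := by simp
      have hmem' : s(y, z) ∈ (Walk.cons h (.cons h' p')).edges := by simp
      have hne : u ≠ z := by
        rintro rfl
        simp [Walk.cons_isPath_iff] at hp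
      rcases hb u y z hne (hf _ hmem) (hf _ hmem') with rfl | rfl
      · exact hbp ⟨hmem, hf _ hmem⟩
      · exact hbp ⟨hmem', hf _ hmem'⟩

lemma one_lt_of_isCFConnected {V : Type*} {G : SimpleGraph V} (hnc : G ≠ ⊤)
    {k : ℕ} {c : Sym2 V → ℕ} (hc : ∀ e ∈ G.edgeSet, c e < k) (h : IsCFConnected G c) :
    1 < k := by
  by_contra hk
  obtain ⟨u, v, huv, hadj⟩ := SimpleGraph.ne_top_iff_exists_not_adj.1 hnc
  obtain ⟨p, hp, col, hcol⟩ := h u v huv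
  have h0 : ∀ e ∈ p.edges, c e = 0 := fun e he ↦ by
    have := hc e (p.edges_subset_edgeSet he)
    lia
  have hlen : 2 ≤ p.length := by
    match p with
    | .nil => exact absurd rfl huv
    | .cons h .nil => exact absurd h hadj
    | .cons h (.cons h' p') => simp
  rw [← List.countP_eq_length_filter] at hcol
  by_cases hz : col = 0
  · subst hz
    rw [List.countP_eq_length.2 fun e he ↦ by simpa using h0 e he, Walk.length_edges] at hcol
    lia
  · rw [List.countP_eq_zero.2 fun e he ↦ by simpa [h0 e he] using Ne.symm hz] at hcol
    lia

lemma cfcNum_eq_two {V : Type*} [Finite V] {G : SimpleGraph V} (hG : G.Connected) (hnc : G ≠ ⊤)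
    (b : Sym2 V) (hb : ∀ x y z : V, x ≠ z → G.IsBridge s(x, y) → G.IsBridge s(y, z) →
      s(x, y) = b ∨ s(y, z) = b) : cfcNum G = 2 := by
  have hmem := exists_isCFConnected hG b hb
  refine le_antisymm (Nat.sInf_le hmem) (le_csInf ⟨2, hmem⟩ ?_)
  rintro k ⟨c, hc, h⟩
  exact one_lt_of_isCFConnected hnc hc h

namespace SimpleGraph

variable {V : Type*} {G : SimpleGraph V}

lemma IsBridge.ne {x y : V} (h : G.IsBridge s(x, y)) : x ≠ y := by
  rintro rfl
  exact isBridge_iff.1 h .rfl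

lemma Connected.adj_of_isBridge (hG : G.Connected) {x y : V} (h : G.IsBridge s(x, y)) :
    G.Adj x y :=
  h.reachable_iff_adj.1 (hG x y)

lemma IsBridge.not_adj_of_adj {x y z : V} (h : G.IsBridge s(x, y)) (hxz : G.Adj x z) :
    ¬ G.Adj z y := by
  intro hzy
  have := isBridge_iff_forall_walk_mem_edges.1 h (.cons hxz (.cons hzy .nil))
  have := hxz.ne
  have := hzy.ne
  simp_all [eq_comm]

lemma IsBridge.not_adj_of_adj_of_adj {x y z w : V} (h : G.IsBridge s(x, y)) (hxz : G.Adj x z)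
    (hzw : G.Adj z w) (hxw : x ≠ w) (hyz : y ≠ z) : ¬ G.Adj w y := by
  intro hwy
  have := isBridge_iff_forall_walk_mem_edges.1 h (.cons hxz (.cons hzw (.cons hwy .nil)))
  have := hxz.ne
  have := h.ne
  simp_all [eq_comm]

/-- Deleting `k` bridges from a connected graph leaves at least `k + 1` components. -/
lemma Connected.card_lt_card_connectedComponent_deleteEdges [Finite V] (hG : G.Connected)
    (F : Finset (Sym2 V)) (hF : ∀ e ∈ F, G.IsBridge e) :
    F.card < Nat.card (G.deleteEdges (F : Set (Sym2 V))).ConnectedComponent := by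
  classical
  induction F using Finset.induction_on with
  | empty =>
    have := hG.nonempty
    simp
  | insert e F he ih =>
    have ih := ih fun e' he' ↦ hF e' (Finset.mem_insert_of_mem he')
    rw [Finset.card_insert_of_notMem he]
    refine lt_of_le_of_lt (Nat.succ_le_of_lt ih) ?_
    have hle : G.deleteEdges ((insert e F : Finset (Sym2 V)) : Set (Sym2 V)) ≤
        G.deleteEdges (F : Set (Sym2 V)) := deleteEdges_anti (by simp)
    refine lt_of_le_of_ne (ConnectedComponent.card_le_card_of_le hle) fun hcard ↦ ?_
    have hinj := ((ConnectedComponent.surjective_map_ofLE hle).bijective_of_nat_card_le hcard.ge).1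
    induction e with | h x y =>
    have hb := hF _ (Finset.mem_insert_self _ _)
    have hadj : (G.deleteEdges (F : Set (Sym2 V))).Adj x y := by
      rw [deleteEdges_adj]
      exact ⟨hG.adj_of_isBridge hb, by simpa using he⟩
    have hxy : (G.deleteEdges
        ((insert s(x, y) F : Finset (Sym2 V)) : Set (Sym2 V))).Reachable x y :=
      ConnectedComponent.eq.1 (hinj (ConnectedComponent.eq.2 hadj.reachable))
    exact isBridge_iff.1 hb (hxy.mono (deleteEdges_anti (by simp)))

section Component

variable {F : Finset (Sym2 V)}

lemma mem_of_adj_of_connectedComponentMk_ne {x y : V} (hadj : G.Adj x y)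
    (hne : (G.deleteEdges (F : Set (Sym2 V))).connectedComponentMk x ≠
      (G.deleteEdges (F : Set (Sym2 V))).connectedComponentMk y) : s(x, y) ∈ F := by
  by_contra h
  refine hne (ConnectedComponent.eq.2 (Adj.reachable ?_))
  rw [deleteEdges_adj]
  exact ⟨hadj, by simpa using h⟩

lemma vdeg_lt_ncard_supp_of_forall_notMem [Finite V] {x : V} (h : ∀ e ∈ F, x ∉ e) :
    vdeg G x < ((G.deleteEdges (F : Set (Sym2 V))).connectedComponentMk x).supp.ncard := by
  refine Set.ncard_lt_ncard ?_
  refine (Set.ssubset_iff_of_subset fun y hy ↦ ?_).2 ⟨x, rfl, by simp⟩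
  by_contra hne
  exact h _ (mem_of_adj_of_connectedComponentMk_ne (F := F) hy fun h ↦ hne h.symm) (by simp)

lemma vdeg_le_ncard_supp_add_one [Finite V] (hF : ∀ e ∈ F, G.IsBridge e)
    {x : V} (hx : ((bridgeGraph G).neighborSet x).ncard ≤ 2) :
    vdeg G x ≤ ((G.deleteEdges (F : Set (Sym2 V))).connectedComponentMk x).supp.ncard + 1 := by
  set K := (G.deleteEdges (F : Set (Sym2 V))).connectedComponentMk x with hK
  have hsub : G.neighborSet x ⊆ (K.supp \ {x}) ∪ (bridgeGraph G).neighborSet x := by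
    intro y hy
    have hy' : G.Adj x y := hy
    by_cases hyK : (G.deleteEdges (F : Set (Sym2 V))).connectedComponentMk y = K
    · exact Or.inl ⟨hyK, hy'.ne'⟩
    · have := hF _ (mem_of_adj_of_connectedComponentMk_ne (F := F) hy' fun h ↦ hyK h.symm)
      exact Or.inr (by simpa [bridgeGraph, this] using hy'.ne)
  have h₁ := Set.ncard_le_ncard hsub
  have h₂ := Set.ncard_union_le (K.supp \ {x}) ((bridgeGraph G).neighborSet x)
  have h₃ := Set.ncard_sdiff_singleton_add_one (s := K.supp) (a := x) rfl
  rw [vdeg]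
  lia

lemma exists_mem_supp_forall_notMem (hF : ∀ e ∈ F, G.IsBridge e)
    (K : (G.deleteEdges (F : Set (Sym2 V))).ConnectedComponent) (hK : F.card < K.supp.ncard) :
    ∃ x ∈ K.supp, ∀ e ∈ F, x ∉ e := by
  by_contra! hcon
  obtain ⟨v, -⟩ := K.nonempty_supp
  have : Nonempty (Sym2 V) := ⟨s(v, v)⟩
  choose! f hfF hxf using hcon
  refine hK.not_ge ?_
  rw [← Set.ncard_coe_finset]
  refine Set.ncard_le_ncard_of_injOn f hfF fun x hx y hy hxy ↦ ?_
  by_contra hne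
  have he : f x = s(x, y) :=
    (Sym2.mem_and_mem_iff hne).1 ⟨hxf x hx, hxy ▸ hxf y hy⟩
  have hr : (G.deleteEdges (F : Set (Sym2 V))).Reachable x y :=
    ConnectedComponent.eq.1 (hx.trans hy.symm)
  have hmem := hfF x hx
  refine isBridge_iff.1 (he ▸ hF _ hmem) (hr.mono (deleteEdges_anti ?_))
  simpa [← he] using hmem

end Component

end SimpleGraph

/-- A connected graph satisfying the degree-sum condition has no four bridges. -/
lemma card_ne_four_of_forall_isBridge {V : Type*} [Fintype V] {G : SimpleGraph V}
    (hn : 33 ≤ Fintype.card V) (hG : G.Connected)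
    (hlf : ∀ v, ((bridgeGraph G).neighborSet v).ncard ≤ 2)
    (hdeg : ∀ x y : V, x ≠ y → ¬ G.Adj x y →
      2 * Fintype.card V ≤ 5 * (vdeg G x + vdeg G y) + 9)
    (F : Finset (Sym2 V)) (hF : ∀ e ∈ F, G.IsBridge e) : F.card ≠ 4 := by
  classical
  intro hF4
  have hcomp := hG.card_lt_card_connectedComponent_deleteEdges F hF
  set H := G.deleteEdges (F : Set (Sym2 V)) with hH
  have hcard : Fintype.card (Fin 5) ≤ Fintype.card H.ConnectedComponent := by
    rw [Fintype.card_fin, ← Nat.card_eq_fintype_card]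
    lia
  obtain ⟨C⟩ := Function.Embedding.nonempty_of_card_le hcard
  obtain ⟨a, ha⟩ : ∃ a : Fin 5 → ℕ, ∀ i, a i = (C i).supp.ncard := ⟨_, fun _ ↦ rfl⟩
  have hpos : ∀ i, 1 ≤ a i := fun i ↦ by
    rw [ha]
    exact (Set.ncard_pos).2 (C i).nonempty_supp
  have hsum : ∑ i, a i ≤ Fintype.card V := by
    have h₁ : ∑ i, a i = ∑ K ∈ Finset.univ.map C, K.supp.ncard := by simp [ha]
    have h₂ : ∑ K : H.ConnectedComponent, K.supp.ncard = Fintype.card V := by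
      rw [← Finset.card_univ, Finset.card_eq_sum_card_fiberwise (f := H.connectedComponentMk)
        (t := Finset.univ) (by simp)]
      refine Finset.sum_congr rfl fun K _ ↦ ?_
      rw [← Set.ncard_coe_finset]
      congr 1
      ext v
      simp
    rw [h₁, ← h₂]
    exact Finset.sum_le_sum_of_subset (Finset.subset_univ _)
  have hmk : ∀ {i x}, x ∈ (C i).supp → H.connectedComponentMk x = C i := fun h ↦ h
  have hmkne : ∀ {i j x y}, i ≠ j → x ∈ (C i).supp → y ∈ (C j).supp →
      H.connectedComponentMk x ≠ H.connectedComponentMk y := fun hij hx hy ↦ by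
    rw [hmk hx, hmk hy]
    exact C.injective.ne hij
  have hne : ∀ {i j x y}, i ≠ j → x ∈ (C i).supp → y ∈ (C j).supp → x ≠ y :=
    fun hij hx hy h ↦ hmkne hij hx hy (h ▸ rfl)
  have hup : ∀ {i x}, x ∈ (C i).supp → vdeg G x ≤ a i + 1 := fun {i x} hx ↦ by
    rw [ha, ← hmk hx]
    exact SimpleGraph.vdeg_le_ncard_supp_add_one hF (hlf x)
  have hlarge : ∀ {i}, 5 ≤ a i → ∃ x ∈ (C i).supp, (∀ e ∈ F, x ∉ e) ∧ vdeg G x < a i := by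
    intro i hi
    obtain ⟨x, hx, hxF⟩ := SimpleGraph.exists_mem_supp_forall_notMem hF (C i) (by
      rw [hF4, ← ha]
      exact hi)
    refine ⟨x, hx, hxF, ?_⟩
    rw [ha, ← hmk hx]
    exact SimpleGraph.vdeg_lt_ncard_supp_of_forall_notMem hxF
  have hbr : ∀ {i j x y}, i ≠ j → x ∈ (C i).supp → y ∈ (C j).supp → G.Adj x y → s(x, y) ∈ F :=
    fun hij hx hy hadj ↦ SimpleGraph.mem_of_adj_of_connectedComponentMk_ne hadj (hmkne hij hx hy)
  have hll : ∀ i j, i ≠ j → 5 ≤ a i → 5 ≤ a j → 2 * Fintype.card V + 1 ≤ 5 * (a i + a j) := by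
    intro i j hij hi hj
    obtain ⟨x, hx, hxF, hdx⟩ := hlarge hi
    obtain ⟨y, hy, -, hdy⟩ := hlarge hj
    have := hdeg x y (hne hij hx hy) fun h ↦ hxF _ (hbr hij hx hy h) (by simp)
    lia
  have hls : ∀ i j, i ≠ j → 5 ≤ a i → 2 * Fintype.card V ≤ 5 * (a i + a j) + 9 := by
    intro i j hij hi
    obtain ⟨x, hx, hxF, hdx⟩ := hlarge hi
    obtain ⟨y, hy⟩ := (C j).nonempty_supp
    have := hdeg x y (hne hij hx hy) fun h ↦ hxF _ (hbr hij hx hy h) (by simp)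
    have := hup hy
    lia
  have hss : ∀ {i j x y}, i ≠ j → a i ≤ 4 → a j ≤ 4 → x ∈ (C i).supp → y ∈ (C j).supp →
      G.Adj x y := by
    intro i j x y hij hi hj hx hy
    by_contra h
    have := hdeg x y (hne hij hx hy) h
    have := hup hx
    have := hup hy
    lia
  have hss₁ : ∀ i j, i ≠ j → a i ≤ 4 → a j ≤ 4 → a i = 1 ∨ a j = 1 := by
    intro i j hij hi hj
    by_contra! hcon
    have hpi := hpos i
    have hpj := hpos j
    obtain ⟨x, x', hx, hx', hxx⟩ := (Set.one_lt_ncard_iff).1 (show 1 < (C i).supp.ncard by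
      rw [← ha]; lia)
    obtain ⟨y, y', hy, hy', hyy⟩ := (Set.one_lt_ncard_iff).1 (show 1 < (C j).supp.ncard by
      rw [← ha]; lia)
    exact (hF _ (hbr hij hx hy (hss hij hi hj hx hy))).not_adj_of_adj_of_adj
      (hss hij hi hj hx hy') (hss hij hi hj hx' hy').symm hxx hyy (hss hij hi hj hx' hy)
  have hsss : ∀ i j k, i ≠ j → i ≠ k → j ≠ k → a i ≤ 4 → a j ≤ 4 → ¬ a k ≤ 4 := by
    intro i j k hij hik hjk hi hj hk
    obtain ⟨x, hx⟩ := (C i).nonempty_supp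
    obtain ⟨y, hy⟩ := (C j).nonempty_supp
    obtain ⟨z, hz⟩ := (C k).nonempty_supp
    exact (hF _ (hbr hij hx hy (hss hij hi hj hx hy))).not_adj_of_adj
      (hss hik hi hk hx hz) (hss hjk hj hk hy hz).symm
  have hsplit : ∀ (S : Finset (Fin 5)) (i : Fin 5),
      (∀ k ∉ S, 2 * Fintype.card V ≤ 5 * (a k + a i) + 9) →
      Sᶜ.card * (2 * Fintype.card V) + 5 * ∑ k ∈ S, a k ≤
        5 * Fintype.card V + Sᶜ.card * (5 * a i + 9) := by
    intro S i h
    have h₁ := Finset.sum_le_sum (s := Sᶜ) fun k hk ↦ h k (by simpa using hk)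
    have h₂ := Finset.sum_add_sum_compl S a
    simp only [Finset.sum_const, smul_eq_mul, mul_add, Finset.sum_add_distrib,
      ← Finset.mul_sum] at h₁ ⊢
    lia
  have htwo : ∀ i j, i ≠ j → a i = 1 → ¬ a j ≤ 4 := by
    intro i j hij hi hj
    have h := hsplit {i, j} i fun k hk ↦ by
      have hk' : i ≠ k ∧ j ≠ k := by simpa [eq_comm] using hk
      exact hls k i hk'.1.symm (not_le.1 (hsss i j k hij hk'.1 hk'.2 (by lia) hj))
    rw [Finset.card_compl, Finset.sum_pair hij, Finset.card_pair hij, Fintype.card_fin] at h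
    have := hpos j
    lia
  by_cases hsmall : ∃ i, a i ≤ 4
  · obtain ⟨i, hi⟩ := hsmall
    have h := hsplit {i} i fun k hk ↦ by
      have hki : k ≠ i := by simpa using hk
      refine hls k i hki (not_lt.1 fun hk4 ↦ ?_)
      rcases hss₁ i k hki.symm hi (by lia) with h | h
      · exact htwo i k hki.symm h (by lia)
      · exact htwo k i hki h hi
    rw [Finset.card_compl, Finset.sum_singleton, Finset.card_singleton, Fintype.card_fin] at h
    lia
  · push Not at hsmall
    rw [Fin.sum_univ_five] at hsum
    have := hll 0 1 (by decide) (hsmall 0) (hsmall 1)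
    have := hll 1 2 (by decide) (hsmall 1) (hsmall 2)
    have := hll 2 3 (by decide) (hsmall 2) (hsmall 3)
    have := hll 3 4 (by decide) (hsmall 3) (hsmall 4)
    have := hll 4 0 (by decide) (hsmall 4) (hsmall 0)
    lia

/-- If there are at most three bridges and they form a linear forest, some edge meets every pair
of adjacent bridges. -/
lemma exists_forall_adjacent_isBridge {V : Type*} {G : SimpleGraph V} [Finite V]
    (hG : G.Connected) (hlf : ∀ v, ((bridgeGraph G).neighborSet v).ncard ≤ 2)
    (h4 : ∀ F : Finset (Sym2 V), (∀ e ∈ F, G.IsBridge e) → F.card ≠ 4) :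
    ∃ b : Sym2 V, ∀ x y z : V, x ≠ z → G.IsBridge s(x, y) → G.IsBridge s(y, z) →
      s(x, y) = b ∨ s(y, z) = b := by
  classical
  have hstar : ∀ {w e f g}, w ∈ e → w ∈ f → w ∈ g → G.IsBridge e → G.IsBridge f → G.IsBridge g →
      e ≠ f → e ≠ g → f ≠ g → False := by
    intro w e f g he hf hg hbe hbf hbg hef heg hfg
    obtain ⟨x, rfl⟩ := he
    obtain ⟨y, rfl⟩ := hf
    obtain ⟨z, rfl⟩ := hg
    have hsub : (({x, y, z} : Finset V) : Set V) ⊆ (bridgeGraph G).neighborSet w := by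
      intro t ht
      have : t = x ∨ t = y ∨ t = z := by simpa using ht
      rcases this with rfl | rfl | rfl
      · simpa [bridgeGraph, hbe] using hbe.ne
      · simpa [bridgeGraph, hbf] using hbf.ne
      · simpa [bridgeGraph, hbg] using hbg.ne
    have hle := (Set.ncard_le_ncard hsub).trans (hlf w)
    rw [Set.ncard_coe_finset, Finset.card_eq_three.2 ⟨x, y, z, fun h ↦ hef (h ▸ rfl),
      fun h ↦ heg (h ▸ rfl), fun h ↦ hfg (h ▸ rfl), rfl⟩] at hle
    lia
  have hfour : ∀ e₁ e₂ e₃ e₄, G.IsBridge e₁ → G.IsBridge e₂ → G.IsBridge e₃ → G.IsBridge e₄ →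
      e₁ ≠ e₂ → e₁ ≠ e₃ → e₁ ≠ e₄ → e₂ ≠ e₃ → e₂ ≠ e₄ → e₃ ≠ e₄ → False := by
    intro e₁ e₂ e₃ e₄ h₁ h₂ h₃ h₄ h₁₂ h₁₃ h₁₄ h₂₃ h₂₄ h₃₄
    refine h4 {e₁, e₂, e₃, e₄} (by simp [h₁, h₂, h₃, h₄]) ?_
    simp [h₁₂, h₁₃, h₁₄, h₂₃, h₂₄, h₃₄]
  by_contra! hcon
  replace hcon : ∀ b, ∃ e f, G.IsBridge e ∧ G.IsBridge f ∧ e ≠ f ∧ e ≠ b ∧ f ≠ b ∧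
      ∃ y, y ∈ e ∧ y ∈ f := by
    intro b
    obtain ⟨x, y, z, hxz, he, hf, heb, hfb⟩ := hcon b
    refine ⟨_, _, he, hf, fun h ↦ ?_, heb, hfb, y, by simp, by simp⟩
    rw [Sym2.eq_swap, Sym2.congr_right] at h
    exact hxz h
  obtain ⟨v₀⟩ := hG.nonempty
  obtain ⟨e₁, e₂, h₁, h₂, h₁₂, -, -, w, hw₁, hw₂⟩ := hcon s(v₀, v₀)
  obtain ⟨g, hg, hg₁, hg₂, p, hp₂, hpg⟩ : ∃ g, G.IsBridge g ∧ g ≠ e₁ ∧ g ≠ e₂ ∧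
      ∃ p, p ∈ e₂ ∧ p ∈ g := by
    obtain ⟨e, f, he, hf, hef, he₁, hf₁, y, hye, hyf⟩ := hcon e₁
    by_cases h : e = e₂
    · subst h
      exact ⟨f, hf, hf₁, hef.symm, y, hye, hyf⟩
    by_cases h' : f = e₂
    · subst h'
      exact ⟨e, he, he₁, hef, y, hyf, hye⟩
    exact (hfour e₁ e₂ e f h₁ h₂ he hf h₁₂ he₁.symm hf₁.symm (Ne.symm h) (Ne.symm h') hef).elim
  obtain ⟨r, hr₁, hrg⟩ : ∃ r, r ∈ e₁ ∧ r ∈ g := by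
    obtain ⟨e, f, he, hf, hef, he₂, hf₂, y, hye, hyf⟩ := hcon e₂
    have key : ∀ e, G.IsBridge e → e ≠ e₂ → e = e₁ ∨ e = g := by
      intro e he he₂
      by_contra! h
      exact hfour e₁ e₂ g e h₁ h₂ hg he h₁₂ hg₁.symm h.1.symm hg₂.symm he₂.symm h.2.symm
    rcases key e he he₂ with rfl | rfl <;> rcases key f hf hf₂ with rfl | rfl
    · exact absurd rfl hef
    · exact ⟨y, hye, hyf⟩
    · exact ⟨y, hyf, hye⟩
    · exact absurd rfl hef
  by_cases hwg : w ∈ g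
  · exact hstar hw₁ hw₂ hwg h₁ h₂ hg h₁₂ hg₁.symm hg₂.symm
  have hwr : w ≠ r := fun h ↦ hwg (h ▸ hrg)
  have hwp : w ≠ p := fun h ↦ hwg (h ▸ hpg)
  obtain rfl := (Sym2.mem_and_mem_iff hwr).1 ⟨hw₁, hr₁⟩
  obtain rfl := (Sym2.mem_and_mem_iff hwp).1 ⟨hw₂, hp₂⟩
  have hrp : r ≠ p := fun h ↦ h₁₂ (h ▸ rfl)
  obtain rfl := (Sym2.mem_and_mem_iff hrp).1 ⟨hrg, hpg⟩
  exact hg.not_adj_of_adj (hG.adj_of_isBridge h₁).symm (hG.adj_of_isBridge h₂)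

theorem stmt_17 {V : Type*} [Fintype V] (G : SimpleGraph V)
    (hn : 33 ≤ Fintype.card V) (hG : G.Connected) (hnc : G ≠ ⊤)
    (hlf : IsLinearForest (bridgeGraph G))
    (hdeg : ∀ x y : V, x ≠ y → ¬G.Adj x y →
      (2 * (Fintype.card V : ℚ) - 9) / 5 ≤ (vdeg G x : ℚ) + (vdeg G y : ℚ)) :
    cfcNum G = 2 := by
  have hdeg' : ∀ x y : V, x ≠ y → ¬ G.Adj x y →
      2 * Fintype.card V ≤ 5 * (vdeg G x + vdeg G y) + 9 := by
    intro x y hxy hadj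
    have := hdeg x y hxy hadj
    rw [div_le_iff₀ (by norm_num)] at this
    have h : (2 * Fintype.card V : ℚ) ≤ 5 * (vdeg G x + vdeg G y) + 9 := by linarith
    exact_mod_cast h
  obtain ⟨b, hb⟩ := exists_forall_adjacent_isBridge hG hlf.2
    (card_ne_four_of_forall_isBridge hn hG hlf.2 hdeg')
  exact cfcNum_eq_two hG hnc b hb
end
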